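/- arXiv:math/0411371 — 3 statements merged into one kernel-verified Lean document; each statement's English description precedes it below -/
import Mathlib

section
/- Let (m₀, h) be a Perron–Ruelle–Frobenius pair with m₀ non-singular, and let μ̂ be the associated measure on X_∞(r). For each measurable harmonic function h₀ : X → ℂ, i.e., R h₀ = h₀ where (Rξ)(x) = (1/#r⁻¹(x)) Σ_{r(y)=x} |m₀(y)|² ξ(y), satisfying |h₀|² ≤ c h² for some c ≥ 0, there exists a unique cocycle f (a bounded measurable f : X_∞(r) → ℂ with f = f∘r̂ μ̂-a.e.) such that h₀ = E₀(f)·h, where E₀ denotes the conditional expectation from L^∞(X_∞(r), μ̂) onto L^∞(X, μ) (the θ₀-measurable functions); conversely, for each cocycle f the function h₀ := E₀(f)·h is harmonic. Moreover, the correspondence is given by f = lim_{n→∞} (h₀/h)∘θ_n, where the limit exists pointwise μ̂-a.e. and in L^p(X_∞(r), μ̂) for all 1 ≤ p < ∞. -/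
open MeasureTheory Filter
open scoped ENNReal Topology

/-- The projective limit (solenoid) of the system `X ← X ← X ← ⋯` under `r`. -/
def Xinf {X : Type} (r : X → X) : Set (ℕ → X) := {x | ∀ n, r (x (n + 1)) = x n}

/-- Projection onto the `n`-th coordinate. -/
def theta {X : Type} (r : X → X) (n : ℕ) (xh : Xinf r) : X := (xh : ℕ → X) n

/-- The induced automorphism `r̂(x₀,x₁,…) = (r x₀, x₀, x₁, …)`. -/
def rhat {X : Type} (r : X → X) (xh : Xinf r) : Xinf r :=
  ⟨fun n => Nat.rec (r ((xh : ℕ → X) 0)) (fun k _ => (xh : ℕ → X) k) n, by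
    intro n
    cases n with
    | zero => rfl
    | succ k => exact xh.2 k⟩

/-- Bounded measurable real functions. -/
def BddMeasurable {Y : Type} [MeasurableSpace Y] (f : Y → ℝ) : Prop :=
  Measurable f ∧ ∃ C, ∀ x, |f x| ≤ C

/-- Bounded measurable complex functions. -/
def BddMeasC {Y : Type} [MeasurableSpace Y] (f : Y → ℂ) : Prop :=
  Measurable f ∧ ∃ C, ∀ x, ‖f x‖ ≤ C

/-- The averaging (transfer) operator `f ↦ (1/#r⁻¹(x)) Σ_{r(y)=x} f(y)`. -/
noncomputable def transfer {Y : Type} (r : Y → Y) (f : Y → ℝ) (x : Y) : ℝ :=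
  (Nat.card (r ⁻¹' {x}) : ℝ)⁻¹ * ∑' y : r ⁻¹' {x}, f y

/-- The Ruelle transfer operator with weight `W`. -/
noncomputable def ruelle {Y : Type} (r : Y → Y) (W : Y → ℝ) (f : Y → ℝ) (x : Y) : ℝ :=
  (Nat.card (r ⁻¹' {x}) : ℝ)⁻¹ * ∑' y : r ⁻¹' {x}, W y * f y

/-- The Ruelle transfer operator with weight `W`, acting on complex functions. -/
noncomputable def ruelleC {Y : Type} (r : Y → Y) (W : Y → ℝ) (f : Y → ℂ) (x : Y) : ℂ :=
  (Nat.card (r ⁻¹' {x}) : ℂ)⁻¹ * ∑' y : r ⁻¹' {x}, (W y : ℂ) * f y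

/-- Strong `r`-invariance of a measure. -/
def StronglyInvariant {Y : Type} [MeasurableSpace Y] (r : Y → Y) (μ : Measure Y) : Prop :=
  ∀ f : Y → ℝ, BddMeasurable f → ∫ x, f x ∂μ = ∫ x, transfer r f x ∂μ

/-- A cocycle on the solenoid: a bounded measurable function invariant under `r̂` a.e. -/
def IsCocycle {X : Type} [MeasurableSpace X] (r : X → X) (μhat : Measure (Xinf r))
    (c : Xinf r → ℂ) : Prop :=
  Measurable c ∧ (∃ C, ∀ xh, ‖c xh‖ ≤ C) ∧ c ∘ rhat r =ᵐ[μhat] c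

/-- The relation `h₀ = E₀(c)·h`, where `E₀` is the conditional expectation onto the
`θ₀`-measurable functions, expressed in its equivalent integral form:
`∫ (g∘θ₀)·c dμ̂ = ∫ g·h₀ dμ` for all bounded measurable `g` on `X` (recall
`μ̂ ∘ θ₀⁻¹ = h dμ`). -/
def CondExpRel {X : Type} [MeasurableSpace X] (r : X → X) (μ : Measure X)
    (μhat : Measure (Xinf r)) (c : Xinf r → ℂ) (h₀ : X → ℂ) : Prop :=
  ∀ g : X → ℂ, BddMeasC g →
    ∫ xh, g (theta r 0 xh) * c xh ∂μhat = ∫ x, g x * h₀ x ∂μ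


namespace HC

lemma transfer_eq {X : Type} {r : X → X} (hfin : ∀ x, (r ⁻¹' {x}).Finite) (f : X → ℝ) (x : X) :
    transfer r f x = (Nat.card (r ⁻¹' {x}) : ℝ)⁻¹ * ∑ y ∈ (hfin x).toFinset, f y := by
  have := (hfin x).fintype
  unfold transfer
  rw [tsum_fintype]
  congr 1
  exact (Finset.sum_subtype _ (by simp) f).symm

lemma transfer_mono {X : Type} {r : X → X} (hfin : ∀ x, (r ⁻¹' {x}).Finite) {f g : X → ℝ} (x : X)
    (hfg : ∀ y, f y ≤ g y) : transfer r f x ≤ transfer r g x := by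
  rw [transfer_eq hfin, transfer_eq hfin]
  gcongr
  exact hfg _

lemma transfer_abs {X : Type} {r : X → X} (hfin : ∀ x, (r ⁻¹' {x}).Finite) {f g : X → ℝ} (x : X)
    (hfg : ∀ y, |f y| ≤ g y) : |transfer r f x| ≤ transfer r g x := by
  rw [transfer_eq hfin, transfer_eq hfin, abs_mul, abs_of_nonneg (by positivity)]
  gcongr
  exact (Finset.abs_sum_le_sum_abs _ _).trans (Finset.sum_le_sum fun y _ => hfg y)

lemma transfer_tendsto {X : Type} {r : X → X} (hfin : ∀ x, (r ⁻¹' {x}).Finite) {f : ℕ → X → ℝ}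
    {g : X → ℝ} (x : X) (hfg : ∀ y, Tendsto (fun n => f n y) atTop (𝓝 (g y))) :
    Tendsto (fun n => transfer r (f n) x) atTop (𝓝 (transfer r g x)) := by
  simp only [transfer_eq hfin]
  exact (tendsto_finsetSum _ fun y _ => hfg y).const_mul _

lemma card_ne {X : Type} {r : X → X} (hsur : Function.Surjective r)
    (hfin : ∀ x, (r ⁻¹' {x}).Finite) (x : X) : (Nat.card (r ⁻¹' {x}) : ℝ) ≠ 0 := by
  have := (hfin x).fintype
  obtain ⟨y, hy⟩ := hsur x
  have : Nonempty (r ⁻¹' {x}) := ⟨⟨y, hy⟩⟩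
  have := (hfin x).to_subtype
  exact_mod_cast (Nat.card_pos).ne'

lemma transfer_add_one {X : Type} {r : X → X} (hsur : Function.Surjective r)
    (hfin : ∀ x, (r ⁻¹' {x}).Finite) (f : X → ℝ) (x : X) :
    transfer r (fun y => f y + 1) x = transfer r f x + 1 := by
  have h1 := card_ne hsur hfin x
  rw [transfer_eq hfin, transfer_eq hfin, Finset.sum_add_distrib, mul_add]
  congr 1
  have : (Nat.card (r ⁻¹' {x})) = (hfin x).toFinset.card := by
    rw [Nat.card_coe_set_eq, Set.ncard_eq_toFinset_card _ (hfin x)]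
  simp only [Finset.sum_const, nsmul_eq_mul, mul_one]
  rw [← this]
  exact inv_mul_cancel₀ h1

lemma integrable_of_tendsto' {X : Type} [MeasurableSpace X]
    {G : ℕ → X → ℝ} {f : X → ℝ} {μ : Measure X}
    (hGf : ∀ᵐ x ∂μ, Tendsto (fun (n : ℕ) ↦ G n x) atTop (𝓝 (f x)))
    (hG : ∀ (n : ℕ), AEStronglyMeasurable (G n) μ)
    (hG' : liminf (fun n ↦ ∫⁻ x, ‖G n x‖ₑ ∂μ) atTop ≠ ⊤) :
    Integrable f μ := by
  refine ⟨aestronglyMeasurable_of_tendsto_ae _ hG hGf, lt_of_le_of_lt ?_ hG'.lt_top⟩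
  refine le_trans (lintegral_mono_ae ?_) (lintegral_liminf_le' fun n => (hG n).enorm)
  filter_upwards [hGf] with x hx
  exact (hx.enorm.liminf_eq).ge


lemma transfer_int_bdd {X : Type} [MeasurableSpace X] {r : X → X}
    (hsur : Function.Surjective r) (hfin : ∀ x, (r ⁻¹' {x}).Finite)
    {μ : Measure X} [IsProbabilityMeasure μ] (hinv : StronglyInvariant r μ)
    {f : X → ℝ} (hf : BddMeasurable f) : Integrable (transfer r f) μ := by
  have key : ∀ g : X → ℝ, BddMeasurable g → ∫ x, g x ∂μ ≠ 0 → Integrable (transfer r g) μ := by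
    intro g hg h0
    by_contra hn
    apply h0
    rw [hinv g hg, integral_undef hn]
  by_cases h0 : ∫ x, f x ∂μ = 0
  · obtain ⟨hm, C, hC⟩ := hf
    have hfi : Integrable f μ := Integrable.of_bound hm.aestronglyMeasurable C
      (Eventually.of_forall hC)
    have := key (fun y => f y + 1) ⟨by fun_prop, C + 1, fun x => by
      refine (abs_add_le _ _).trans ?_
      simpa using hC x⟩ (by
        rw [integral_add hfi (integrable_const _), h0]; simp)
    have h2 := this.sub (integrable_const (1:ℝ))
    refine h2.congr (Eventually.of_forall fun x => ?_)
    simp [transfer_add_one hsur hfin]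
  · exact key f hf h0

lemma transfer_null {X : Type} [MeasurableSpace X] {r : X → X}
    (hsur : Function.Surjective r) (hfin : ∀ x, (r ⁻¹' {x}).Finite)
    {μ : Measure X} [IsProbabilityMeasure μ] (hinv : StronglyInvariant r μ)
    {N : Set X} (hN : MeasurableSet N) (h0 : μ N = 0) :
    ∀ᵐ x ∂μ, ∀ y, r y = x → y ∉ N := by
  have hb : BddMeasurable (N.indicator (fun _ => (1:ℝ))) :=
    ⟨measurable_const.indicator hN, 1, fun x => by
      by_cases hx : x ∈ N <;> simp [hx]⟩
  have h1 := hinv _ hb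
  rw [integral_indicator hN] at h1
  rw [Measure.restrict_eq_zero.2 h0, integral_zero_measure] at h1
  have h2 := (integral_eq_zero_iff_of_nonneg (fun x => ?_)
    (transfer_int_bdd hsur hfin hinv hb)).1 h1.symm
  · filter_upwards [h2] with x hx y hy hyN
    rw [transfer_eq hfin] at hx
    simp only [Pi.zero_apply, mul_eq_zero, inv_eq_zero, card_ne hsur hfin x, false_or] at hx
    rw [Finset.sum_eq_zero_iff_of_nonneg] at hx
    · have := hx y (by simpa using hy)
      simp [hyN] at this
    · intro i _
      exact Set.indicator_nonneg (by simp) _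
  · rw [transfer_eq hfin]
    have : 0 ≤ ∑ y ∈ (hfin x).toFinset, N.indicator (fun _ => (1:ℝ)) y :=
      Finset.sum_nonneg fun i _ => Set.indicator_nonneg (by simp) _
    simp only [Pi.zero_apply]
    positivity

lemma transfer_congr {X : Type} [MeasurableSpace X] {r : X → X}
    (hsur : Function.Surjective r) (hfin : ∀ x, (r ⁻¹' {x}).Finite)
    {μ : Measure X} [IsProbabilityMeasure μ] (hinv : StronglyInvariant r μ)
    {f g : X → ℝ} (hfg : f =ᵐ[μ] g) : transfer r f =ᵐ[μ] transfer r g := by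
  obtain ⟨N, hsub, hN, h0⟩ := exists_measurable_superset_of_null hfg
  filter_upwards [transfer_null hsur hfin hinv hN h0] with x hx
  rw [transfer_eq hfin, transfer_eq hfin]
  congr 1
  refine Finset.sum_congr rfl fun y hy => ?_
  have := hx y (by simpa using hy)
  by_contra hne
  exact this (hsub hne)

lemma transfer_meas {X : Type} [MeasurableSpace X] {r : X → X}
    (hsur : Function.Surjective r) (hfin : ∀ x, (r ⁻¹' {x}).Finite)
    {μ : Measure X} [IsProbabilityMeasure μ] (hinv : StronglyInvariant r μ)
    {f : X → ℝ} (hf : Measurable f) : AEStronglyMeasurable (transfer r f) μ := by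
  refine aestronglyMeasurable_of_tendsto_ae atTop
    (f := fun n : ℕ => transfer r (fun y => max (-(n:ℝ)) (min (f y) n))) (fun n => ?_)
    (Eventually.of_forall fun x => transfer_tendsto hfin x fun y => ?_)
  · refine (transfer_int_bdd hsur hfin hinv ⟨by fun_prop, n, fun x => ?_⟩).1
    rw [abs_le]
    exact ⟨le_max_left _ _, max_le (by linarith [Nat.cast_nonneg (α := ℝ) n]) (min_le_right _ _)⟩
  · refine tendsto_const_nhds.congr' ?_
    obtain ⟨n, hn⟩ := exists_nat_ge |f y|
    filter_upwards [eventually_ge_atTop n] with m hm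
    have : (n:ℝ) ≤ m := by exact_mod_cast hm
    have h1 := abs_le.1 (hn.trans this)
    rw [min_eq_left h1.2, max_eq_right h1.1]

lemma transfer_int_nonneg {X : Type} [MeasurableSpace X] {r : X → X}
    (hsur : Function.Surjective r) (hfin : ∀ x, (r ⁻¹' {x}).Finite)
    {μ : Measure X} [IsProbabilityMeasure μ] (hinv : StronglyInvariant r μ)
    {f : X → ℝ} (hf : Measurable f) (hi : Integrable f μ)
    (hp : ∀ x, 0 ≤ f x) : Integrable (transfer r f) μ := by
  have hnn : ∀ (g : X → ℝ), (∀ x, 0 ≤ g x) → ∀ x, 0 ≤ transfer r g x := fun g hg x =>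
    (abs_nonneg _).trans (transfer_abs hfin (f := g) x fun y => (abs_of_nonneg (hg y)).le)
  have hb : ∀ n : ℕ, BddMeasurable (fun y => min (f y) n) := fun n =>
    ⟨by fun_prop, n, fun x => by
      rw [abs_of_nonneg (le_min (hp x) (by positivity))]; exact min_le_right _ _⟩
  refine integrable_of_tendsto' (G := fun n : ℕ => transfer r (fun y => min (f y) n)) 
    (Eventually.of_forall fun x => transfer_tendsto hfin x fun y => ?_) (fun n => ?_) ?_
  · refine tendsto_const_nhds.congr' ?_
    obtain ⟨n, hn⟩ := exists_nat_ge (f y)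
    filter_upwards [eventually_ge_atTop n] with m hm
    have : (n:ℝ) ≤ m := by exact_mod_cast hm
    rw [min_eq_left (hn.trans this)]
  · exact (transfer_int_bdd hsur hfin hinv (hb n)).1
  · have hle : ∀ n : ℕ, ∫⁻ x, ‖transfer r (fun y => min (f y) n) x‖ₑ ∂μ
        ≤ ENNReal.ofReal (∫ x, f x ∂μ) := by
      intro n
      have h1 := ofReal_integral_eq_lintegral_ofReal (transfer_int_bdd hsur hfin hinv (hb n))
        (Eventually.of_forall (hnn _ fun x => le_min (hp x) (by positivity)))
      calc _ = ∫⁻ x, ENNReal.ofReal (transfer r (fun y => min (f y) n) x) ∂μ := by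
            refine lintegral_congr fun x => ?_
            rw [Real.enorm_eq_ofReal (hnn _ (fun x => le_min (hp x) (by positivity)) x)]
        _ ≤ _ := by
          rw [← h1, ← hinv _ (hb n)]
          apply ENNReal.ofReal_le_ofReal
          refine integral_mono ?_ hi fun x => min_le_left _ _
          exact hi.mono (by fun_prop) (Eventually.of_forall fun x => by
            rw [Real.norm_of_nonneg (le_min (hp x) (by positivity)), Real.norm_of_nonneg (hp x)]
            exact min_le_left _ _)
    refine ne_top_of_le_ne_top (b := ENNReal.ofReal (∫ x, f x ∂μ)) ENNReal.ofReal_ne_top ?_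
    exact (liminf_le_liminf (Eventually.of_forall hle)).trans (by simp)

lemma transfer_main {X : Type} [MeasurableSpace X] {r : X → X}
    (hsur : Function.Surjective r) (hfin : ∀ x, (r ⁻¹' {x}).Finite)
    {μ : Measure X} [IsProbabilityMeasure μ] (hinv : StronglyInvariant r μ)
    {f : X → ℝ} (hi : Integrable f μ) :
    Integrable (transfer r f) μ ∧ ∫ x, transfer r f x ∂μ = ∫ x, f x ∂μ := by
  wlog hm : Measurable f generalizing f
  · have hm' := hi.1.aemeasurable
    have := this (hi.congr hm'.ae_eq_mk) hm'.measurable_mk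
    have hc := transfer_congr hsur hfin hinv hm'.ae_eq_mk
    refine ⟨this.1.congr hc.symm, ?_⟩
    rw [integral_congr_ae hc, this.2, integral_congr_ae hm'.ae_eq_mk.symm]
  have habs := transfer_int_nonneg hsur hfin hinv (f := fun y => |f y|) (by fun_prop) hi.abs
    (fun x => abs_nonneg _)
  refine ⟨habs.mono' (transfer_meas hsur hfin hinv hm) (Eventually.of_forall fun x =>
    transfer_abs hfin x fun y => le_rfl), ?_⟩
  let F : ℕ → X → ℝ := fun n y => max (-(n:ℝ)) (min (f y) n)
  have hF : ∀ n, BddMeasurable (F n) := fun n => by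
    refine ⟨by fun_prop, n, fun x => ?_⟩
    rw [abs_le]
    exact ⟨le_max_left _ _, max_le (by linarith [Nat.cast_nonneg (α := ℝ) n]) (min_le_right _ _)⟩
  have hFle : ∀ n y, |F n y| ≤ |f y| := by
    intro n y
    have h0 : (0:ℝ) ≤ n := by positivity
    simp only [F]
    rcases le_total 0 (f y) with h | h
    · rw [max_eq_right ((neg_nonpos.2 h0).trans (le_min h h0)), abs_of_nonneg (le_min h h0),
        abs_of_nonneg h]
      exact min_le_left _ _
    · rw [min_eq_left (h.trans h0), abs_of_nonpos (max_le (by linarith) h), abs_of_nonpos h]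
      exact neg_le_neg (le_max_right _ _)
  have hFl : ∀ y, Tendsto (fun n => F n y) atTop (𝓝 (f y)) := by
    intro y
    refine tendsto_const_nhds.congr' ?_
    obtain ⟨n, hn⟩ := exists_nat_ge |f y|
    filter_upwards [eventually_ge_atTop n] with m hm
    have : (n:ℝ) ≤ m := by exact_mod_cast hm
    have h1 := abs_le.1 (hn.trans this)
    simp only [F]
    rw [min_eq_left h1.2, max_eq_right h1.1]
  have t1 := tendsto_integral_of_dominated_convergence (μ := μ) (fun y => |f y|)
    (fun n => (hF n).1.aestronglyMeasurable) hi.abs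
    (fun n => Eventually.of_forall (hFle n)) (Eventually.of_forall hFl)
  have t2 := tendsto_integral_of_dominated_convergence (μ := μ) (F := fun n => transfer r (F n)) _
    (fun n => (transfer_int_bdd hsur hfin hinv (hF n)).1) habs
    (fun n => Eventually.of_forall fun x => transfer_abs hfin x (hFle n))
    (Eventually.of_forall fun x => transfer_tendsto hfin x hFl)
  refine tendsto_nhds_unique t2 (t1.congr fun n => hinv _ (hF n))


/-- The averaging operator on complex functions, via real and imaginary parts. -/
noncomputable def trC {X : Type} (r : X → X) (f : X → ℂ) (x : X) : ℂ :=
  (transfer r (fun y => (f y).re) x : ℂ) + (transfer r (fun y => (f y).im) x : ℂ) * Complex.I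

lemma trC_eq {X : Type} {r : X → X} (hfin : ∀ x, (r ⁻¹' {x}).Finite) (f : X → ℂ) (x : X) :
    trC r f x = (Nat.card (r ⁻¹' {x}) : ℂ)⁻¹ * ∑ y ∈ (hfin x).toFinset, f y := by
  unfold trC
  rw [transfer_eq hfin, transfer_eq hfin]
  push_cast
  rw [mul_assoc, ← mul_add, Finset.sum_mul, ← Finset.sum_add_distrib]
  congr 1
  exact Finset.sum_congr rfl fun y _ => Complex.re_add_im _

lemma mul_ruelleC {X : Type} {r : X → X} (hfin : ∀ x, (r ⁻¹' {x}).Finite) (W : X → ℝ)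
    (u F : X → ℂ) (x : X) :
    u x * ruelleC r W F x = trC r (fun y => W y * u (r y) * F y) x := by
  rw [trC_eq hfin]
  have := (hfin x).fintype
  unfold ruelleC
  rw [tsum_fintype]
  rw [← Finset.sum_subtype (hfin x).toFinset (by simp) (fun y => (W y : ℂ) * F y),
    mul_left_comm]
  congr 1
  rw [Finset.mul_sum]
  refine Finset.sum_congr rfl fun y hy => ?_
  have : r y = x := by simpa using hy
  rw [this]; ring

lemma mul_ruelle {X : Type} {r : X → X} (hfin : ∀ x, (r ⁻¹' {x}).Finite) (W : X → ℝ)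
    (u F : X → ℝ) (x : X) :
    u x * ruelle r W F x = transfer r (fun y => W y * u (r y) * F y) x := by
  rw [transfer_eq hfin]
  have := (hfin x).fintype
  unfold ruelle
  rw [tsum_fintype]
  rw [← Finset.sum_subtype (hfin x).toFinset (by simp) (fun y => W y * F y),
    mul_left_comm]
  congr 1
  rw [Finset.mul_sum]
  refine Finset.sum_congr rfl fun y hy => ?_
  have : r y = x := by simpa using hy
  rw [this]; ring

/-- Iterated weight. -/
noncomputable def Wn {X : Type} (r : X → X) (W : X → ℝ) (n : ℕ) (x : X) : ℝ :=
  ∏ k ∈ Finset.range n, W (r^[k] x)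

lemma Wn_zero {X : Type} (r : X → X) (W : X → ℝ) (x : X) : Wn r W 0 x = 1 := by simp [Wn]

lemma Wn_succ {X : Type} (r : X → X) (W : X → ℝ) (n : ℕ) (x : X) :
    Wn r W (n+1) x = Wn r W n x * W (r^[n] x) := by simp [Wn, Finset.prod_range_succ]

lemma Wn_succ' {X : Type} (r : X → X) (W : X → ℝ) (n : ℕ) (x : X) :
    Wn r W (n+1) x = W x * Wn r W n (r x) := by
  simp [Wn, Finset.prod_range_succ', mul_comm]

lemma Wn_nonneg {X : Type} (r : X → X) {W : X → ℝ} (hW : ∀ x, 0 ≤ W x) (n : ℕ) (x : X) :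
    0 ≤ Wn r W n x := Finset.prod_nonneg fun _ _ => hW _

lemma Wn_meas {X : Type} [MeasurableSpace X] {r : X → X} (hr : Measurable r) {W : X → ℝ}
    (hW : Measurable W) (n : ℕ) : Measurable (Wn r W n) :=
  Finset.measurable_fun_prod _ fun k _ => hW.comp (hr.iterate k)

lemma Wn_bdd {X : Type} (r : X → X) {W : X → ℝ} {B : ℝ} (hB : ∀ x, |W x| ≤ B) (n : ℕ)
    (x : X) : |Wn r W n x| ≤ B ^ n := by
  induction n with
  | zero => simp [Wn]
  | succ n ih =>
    rw [Wn_succ, abs_mul, pow_succ]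
    exact mul_le_mul ih (hB _) (abs_nonneg _) ((abs_nonneg _).trans ih)


lemma trC_main {X : Type} [MeasurableSpace X] {r : X → X}
    (hsur : Function.Surjective r) (hfin : ∀ x, (r ⁻¹' {x}).Finite)
    {μ : Measure X} [IsProbabilityMeasure μ] (hinv : StronglyInvariant r μ)
    {f : X → ℂ} (hi : Integrable f μ) :
    Integrable (trC r f) μ ∧ ∫ x, trC r f x ∂μ = ∫ x, f x ∂μ := by
  obtain ⟨a1, a2⟩ := transfer_main hsur hfin hinv hi.re
  obtain ⟨b1, b2⟩ := transfer_main hsur hfin hinv hi.im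
  have a3 : Integrable (fun x => (transfer r (fun y => (f y).re) x : ℂ)) μ := a1.ofReal
  have b3 : Integrable (fun x => (transfer r (fun y => (f y).im) x : ℂ) * Complex.I) μ :=
    Integrable.mul_const b1.ofReal _
  refine ⟨a3.add b3, ?_⟩
  unfold trC
  rw [integral_add a3 b3, integral_mul_const]
  rw [integral_complex_ofReal, integral_complex_ofReal]
  have := integral_re_add_im hi
  rw [← a2, ← b2] at this
  exact this

lemma ruelleC_main {X : Type} [MeasurableSpace X] {r : X → X} (hr : Measurable r)
    (hsur : Function.Surjective r) (hfin : ∀ x, (r ⁻¹' {x}).Finite)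
    {μ : Measure X} [IsProbabilityMeasure μ] (hinv : StronglyInvariant r μ)
    {W : X → ℝ} (hW : Measurable W) {B : ℝ} (hB : ∀ x, |W x| ≤ B)
    {u : X → ℂ} (hu : BddMeasC u) {F : X → ℂ} (hF : Integrable F μ) :
    Integrable (fun x => u x * ruelleC r W F x) μ ∧
    ∫ x, u x * ruelleC r W F x ∂μ = ∫ x, W x * u (r x) * F x ∂μ := by
  simp only [mul_ruelleC hfin]
  obtain ⟨hm, C, hC⟩ := hu
  refine trC_main hsur hfin hinv (hF.bdd_mul (c := B * C) ?_ (Eventually.of_forall fun x => ?_))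
  · have := hm.comp hr
    have : Measurable fun x => (W x : ℂ) * u (r x) := by fun_prop
    exact this.aestronglyMeasurable
  · rw [norm_mul, Complex.norm_real]
    exact mul_le_mul (hB x) (hC _) (norm_nonneg _) ((abs_nonneg _).trans (hB x))

lemma ruelle_main {X : Type} [MeasurableSpace X] {r : X → X} (hr : Measurable r)
    (hsur : Function.Surjective r) (hfin : ∀ x, (r ⁻¹' {x}).Finite)
    {μ : Measure X} [IsProbabilityMeasure μ] (hinv : StronglyInvariant r μ)
    {W : X → ℝ} (hW : Measurable W) {B : ℝ} (hB : ∀ x, |W x| ≤ B)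
    {u : X → ℝ} (hu : BddMeasurable u) {F : X → ℝ} (hF : Integrable F μ) :
    Integrable (fun x => u x * ruelle r W F x) μ ∧
    ∫ x, u x * ruelle r W F x ∂μ = ∫ x, W x * u (r x) * F x ∂μ := by
  simp only [mul_ruelle hfin]
  obtain ⟨hm, C, hC⟩ := hu
  refine transfer_main hsur hfin hinv (hF.bdd_mul (c := B * C) ?_ (Eventually.of_forall fun x => ?_))
  · have := hm.comp hr
    have : Measurable fun x => W x * u (r x) := by fun_prop
    exact this.aestronglyMeasurable
  · rw [norm_mul]
    exact mul_le_mul (hB x) (hC _) (norm_nonneg _) ((abs_nonneg _).trans (hB x))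

lemma iter_main {X : Type} [MeasurableSpace X] {r : X → X} (hr : Measurable r)
    (hsur : Function.Surjective r) (hfin : ∀ x, (r ⁻¹' {x}).Finite)
    {μ : Measure X} [IsProbabilityMeasure μ] (hinv : StronglyInvariant r μ)
    {W : X → ℝ} (hW : Measurable W) {B : ℝ} (hB : ∀ x, |W x| ≤ B) (n : ℕ) :
    ∀ {F : X → ℝ}, Integrable F μ →
    ∫ x, (ruelle r W)^[n] F x ∂μ = ∫ x, Wn r W n x * F x ∂μ := by
  induction n with
  | zero => intro F hF; simp [Wn]
  | succ n ih =>
    intro F hF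
    rw [Function.iterate_succ_apply]
    have h1 := ruelle_main hr hsur hfin hinv hW hB
      (u := fun _ => 1) ⟨measurable_const, 1, by simp⟩ hF
    simp only [one_mul] at h1
    rw [ih h1.1, (ruelle_main hr hsur hfin hinv hW hB
      ⟨Wn_meas hr hW n, B^n, fun x => Wn_bdd r hB n x⟩ hF).2]
    simp only [Wn_succ']

lemma map_theta {X : Type} [MeasurableSpace X] {r : X → X} (hr : Measurable r)
    (hsur : Function.Surjective r) (hfin : ∀ x, (r ⁻¹' {x}).Finite)
    {μ : Measure X} [IsProbabilityMeasure μ] (hinv : StronglyInvariant r μ)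
    {W : X → ℝ} (hW : Measurable W) {B : ℝ} (hB : ∀ x, |W x| ≤ B)
    (hW0 : ∀ x, 0 ≤ W x)
    {h : X → ℝ} (hint : Integrable h μ) (hpos : ∀ x, 0 ≤ h x)
    (μhat : Measure (Xinf r))
    (hμhat : ∀ (n : ℕ) (E : Set X), MeasurableSet E →
      μhat (theta r n ⁻¹' E) =
        ENNReal.ofReal (∫ x, (ruelle r W)^[n] (E.indicator h) x ∂μ)) (n : ℕ)
    (E : Set X) (hE : MeasurableSet E) :
    μhat (theta r n ⁻¹' E) = ∫⁻ x in E, ENNReal.ofReal (Wn r W n x * h x) ∂μ := by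
  rw [hμhat n E hE, iter_main hr hsur hfin hinv hW hB n (hint.indicator hE)]
  have h2 : Integrable (fun x => Wn r W n x * h x) μ :=
    hint.bdd_mul (c := B ^ n) (Wn_meas hr hW n).aestronglyMeasurable
      (Eventually.of_forall fun x => Wn_bdd r hB n x)
  have : (fun x => Wn r W n x * E.indicator h x) = E.indicator (fun x => Wn r W n x * h x) := by
    ext x; by_cases hx : x ∈ E <;> simp [hx]
  rw [this, integral_indicator hE, ofReal_integral_eq_lintegral_ofReal h2.integrableOn
    (Eventually.of_forall fun x => mul_nonneg (Wn_nonneg r hW0 n x) (hpos x))]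


lemma theta_meas {X : Type} [MeasurableSpace X] (r : X → X) (n : ℕ) : Measurable (theta r n) :=
  (measurable_pi_apply n).comp measurable_subtype_coe

lemma theta_succ {X : Type} (r : X → X) (n : ℕ) (x : Xinf r) :
    r (theta r (n+1) x) = theta r n x := x.2 n

lemma theta_iter {X : Type} (r : X → X) (n k : ℕ) (x : Xinf r) :
    r^[k] (theta r (n+k) x) = theta r n x := by
  induction k with
  | zero => rfl
  | succ k ih => rw [Function.iterate_succ_apply, ← add_assoc, theta_succ r, ih]

lemma theta_iter0 {X : Type} (r : X → X) (k : ℕ) (x : Xinf r) :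
    r^[k] (theta r k x) = theta r 0 x := by
  simpa using theta_iter r 0 k x

lemma theta_rhat_zero {X : Type} (r : X → X) (x : Xinf r) :
    theta r 0 (rhat r x) = r (theta r 0 x) := rfl

lemma theta_rhat_succ {X : Type} (r : X → X) (n : ℕ) (x : Xinf r) :
    theta r (n+1) (rhat r x) = theta r n x := rfl

lemma rhat_meas {X : Type} [MeasurableSpace X] {r : X → X} (hr : Measurable r) :
    Measurable (rhat r) := by
  refine Measurable.subtype_mk (measurable_pi_lambda _ fun n => ?_)
  cases n with
  | zero => exact hr.comp (theta_meas r 0)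
  | succ n => exact theta_meas r n

/-- Cylinder sets. -/
def cyl {X : Type} [MeasurableSpace X] (r : X → X) : Set (Set (Xinf r)) :=
  {s | ∃ n, ∃ A : Set X, MeasurableSet A ∧ theta r n ⁻¹' A = s}

lemma cyl_gen {X : Type} [MeasurableSpace X] (r : X → X) :
    (inferInstance : MeasurableSpace (Xinf r)) = MeasurableSpace.generateFrom (cyl r) := by
  apply le_antisymm
  · change MeasurableSpace.comap _ _ ≤ _
    rw [← measurable_iff_comap_le]
    refine @measurable_pi_lambda _ _ _ (_) _ _ fun n => ?_
    intro A hA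
    exact MeasurableSpace.measurableSet_generateFrom ⟨n, A, hA, rfl⟩
  · refine MeasurableSpace.generateFrom_le ?_
    rintro _ ⟨n, A, hA, rfl⟩
    exact theta_meas r n hA

lemma cyl_pi {X : Type} [MeasurableSpace X] {r : X → X} (hr : Measurable r) :
    IsPiSystem (cyl r) := by
  rintro _ ⟨n, A, hA, rfl⟩ _ ⟨m, B, hB, rfl⟩ -
  rcases le_total n m with hnm | hnm
  · obtain ⟨k, rfl⟩ := Nat.exists_eq_add_of_le hnm
    refine ⟨n + k, (r^[k]) ⁻¹' A ∩ B, ((hr.iterate k) hA).inter hB, ?_⟩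
    ext x
    simp [theta_iter]
  · obtain ⟨k, rfl⟩ := Nat.exists_eq_add_of_le hnm
    refine ⟨m + k, A ∩ (r^[k]) ⁻¹' B, hA.inter ((hr.iterate k) hB), ?_⟩
    ext x
    simp [theta_iter]

lemma ae_eq_of_cyl {X : Type} [MeasurableSpace X] {r : X → X} (hr : Measurable r)
    {ν : Measure (Xinf r)} [IsFiniteMeasure ν] {f g : Xinf r → ℂ} (hf : Integrable f ν)
    (hg : Integrable g ν)
    (H : ∀ n (A : Set X), MeasurableSet A →
      ∫ x in theta r n ⁻¹' A, f x ∂ν = ∫ x in theta r n ⁻¹' A, g x ∂ν) : f =ᵐ[ν] g := by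
  refine Integrable.ae_eq_of_forall_setIntegral_eq f g hf hg fun s hs _ => ?_
  have huniv : ∫ x, f x ∂ν = ∫ x, g x ∂ν := by
    simpa using H 0 Set.univ MeasurableSet.univ
  induction s, hs using MeasurableSpace.induction_on_inter (cyl_gen r) (cyl_pi hr) with
  | empty => simp
  | basic t ht => obtain ⟨n, A, hA, rfl⟩ := ht; exact H n A hA
  | compl t ht ih =>
    rw [setIntegral_compl ht hf, setIntegral_compl ht hg, huniv, ih (measure_lt_top _ _)]
  | iUnion F hd hm ih =>
    rw [integral_iUnion hm hd hf.integrableOn, integral_iUnion hm hd hg.integrableOn]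
    exact tsum_congr fun i => ih i (measure_lt_top _ _)


lemma map_eq {X : Type} [MeasurableSpace X] {r : X → X} {μ : Measure X} {μhat : Measure (Xinf r)}
    {D : X → ℝ} (n : ℕ)
    (H : ∀ (E : Set X), MeasurableSet E →
      μhat (theta r n ⁻¹' E) = ∫⁻ x in E, ENNReal.ofReal (D x) ∂μ) :
    μhat.map (theta r n) = μ.withDensity (fun x => ENNReal.ofReal (D x)) := by
  ext E hE
  rw [Measure.map_apply (theta_meas r n) hE, withDensity_apply _ hE, H E hE]

lemma int_theta {X : Type} [MeasurableSpace X] {r : X → X} {μ : Measure X}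
    {μhat : Measure (Xinf r)}
    {D : X → ℝ} (hD : Measurable D) (hD0 : ∀ x, 0 ≤ D x) {n : ℕ}
    (H : μhat.map (theta r n) = μ.withDensity (fun x => ENNReal.ofReal (D x)))
    {G : X → ℂ} (hG : Measurable G) :
    ∫ x, G (theta r n x) ∂μhat = ∫ x, (D x : ℂ) * G x ∂μ := by
  rw [← integral_map (theta_meas r n).aemeasurable hG.aestronglyMeasurable, H,
    integral_withDensity_eq_integral_toReal_smul (by fun_prop)
      (Eventually.of_forall fun x => ENNReal.ofReal_lt_top)]
  refine integral_congr_ae (Eventually.of_forall fun x => ?_)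
  simp [ENNReal.toReal_ofReal (hD0 x)]

lemma rhat_inv {X : Type} [MeasurableSpace X] {r : X → X} (hr : Measurable r) {μ : Measure X}
    {μhat : Measure (Xinf r)} [IsFiniteMeasure μhat] {W h : X → ℝ} (hW : Measurable W)
    (hW0 : ∀ x, 0 ≤ W x) (hh : Measurable h)
    (H : ∀ n (E : Set X), MeasurableSet E →
      μhat (theta r n ⁻¹' E) = ∫⁻ x in E, ENNReal.ofReal (Wn r W n x * h x) ∂μ) :
    μhat = (μhat.withDensity (fun x => ENNReal.ofReal (W (theta r 0 x)))).map (rhat r) := by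
  have key : ∀ n (A : Set X), MeasurableSet A → μhat (theta r n ⁻¹' A) =
      (μhat.withDensity (fun x => ENNReal.ofReal (W (theta r 0 x)))).map (rhat r)
        (theta r n ⁻¹' A) := by
    intro n A hA
    have hB : MeasurableSet (r ⁻¹' A) := hr hA
    have e1 : theta r n ⁻¹' A = theta r (n+1) ⁻¹' (r ⁻¹' A) := by
      ext x; simp [theta_succ r]
    have e2 : rhat r ⁻¹' (theta r (n+1) ⁻¹' (r ⁻¹' A)) = theta r n ⁻¹' (r ⁻¹' A) := by
      ext x; simp [theta_rhat_succ]
    rw [e1, Measure.map_apply (rhat_meas hr) (theta_meas r _ hB), e2,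
      withDensity_apply _ (theta_meas r _ hB), H _ _ hB]
    have e3 : ∀ x : Xinf r, ENNReal.ofReal (W (theta r 0 x)) =
        (fun y => ENNReal.ofReal (W (r^[n] y))) (theta r n x) := by
      intro x; simp only [theta_iter0 r]
    have hm : Measurable (fun y => ENNReal.ofReal (W (r^[n] y))) :=
      (hW.comp (hr.iterate n)).ennreal_ofReal
    simp_rw [e3]
    rw [← setLIntegral_map hB hm (theta_meas r n), map_eq n (H n),
      setLIntegral_withDensity_eq_setLIntegral_mul _
        (show Measurable fun x => ENNReal.ofReal (Wn r W n x * h x) from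
          ((Wn_meas hr hW n).mul hh).ennreal_ofReal) hm hB]
    refine lintegral_congr fun x => ?_
    simp only [Pi.mul_apply]
    rw [← ENNReal.ofReal_mul' (hW0 _), Wn_succ]
    congr 1; ring
  refine ext_of_generate_finite (cyl r) (cyl_gen r) (cyl_pi hr) ?_ ?_
  · rintro _ ⟨n, A, hA, rfl⟩
    exact key n A hA
  · simpa using key 0 Set.univ MeasurableSet.univ

lemma int_rhat {X : Type} [MeasurableSpace X] {r : X → X} (hr : Measurable r)
    {μhat : Measure (Xinf r)} {W : X → ℝ} (hW : Measurable W)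
    (hW0 : ∀ x, 0 ≤ W x)
    (H : μhat = (μhat.withDensity (fun x => ENNReal.ofReal (W (theta r 0 x)))).map (rhat r))
    {F : Xinf r → ℂ} (hF : Measurable F) :
    ∫ x, F x ∂μhat = ∫ x, (W (theta r 0 x) : ℂ) * F (rhat r x) ∂μhat := by
  conv_lhs => rw [H]
  have hm : Measurable fun x => W (theta r 0 x) := hW.comp (theta_meas r 0)
  rw [integral_map (rhat_meas hr).aemeasurable hF.aestronglyMeasurable,
    integral_withDensity_eq_integral_toReal_smul hm.ennreal_ofReal
      (Eventually.of_forall fun x => ENNReal.ofReal_lt_top)]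
  refine integral_congr_ae (Eventually.of_forall fun x => ?_)
  simp [ENNReal.toReal_ofReal (hW0 _)]

/-- Iterating the quasi-invariance: the integral against the `n`-th coordinate. -/
lemma cocycle_succ {X : Type} [MeasurableSpace X] {r : X → X} (hr : Measurable r)
    {μhat : Measure (Xinf r)} {W : X → ℝ} (hW : Measurable W)
    (hW0 : ∀ x, 0 ≤ W x)
    (H : μhat = (μhat.withDensity (fun x => ENNReal.ofReal (W (theta r 0 x)))).map (rhat r))
    {f : Xinf r → ℂ} (hf : IsCocycle r μhat f) {u : Xinf r → ℂ} (hu : Measurable u) :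
    ∫ x, u x * f x ∂μhat = ∫ x, (W (theta r 0 x) : ℂ) * u (rhat r x) * f x ∂μhat := by
  rw [int_rhat hr hW hW0 H (F := fun x => u x * f x) (hu.mul hf.1)]
  refine integral_congr_ae ?_
  filter_upwards [hf.2.2] with x hx
  simp only [Function.comp_apply] at hx
  rw [hx]; ring

lemma bmC_mul {Y : Type} [MeasurableSpace Y] {f g : Y → ℂ} (hf : BddMeasC f) (hg : BddMeasC g) :
    BddMeasC (fun x => f x * g x) := by
  obtain ⟨a, C, hC⟩ := hf
  obtain ⟨b, D, hD⟩ := hg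
  refine ⟨a.mul b, C * D, fun x => ?_⟩
  rw [norm_mul]
  exact mul_le_mul (hC x) (hD x) (norm_nonneg _) ((norm_nonneg _).trans (hC x))

lemma bmC_comp {Y Z : Type} [MeasurableSpace Y] [MeasurableSpace Z] {f : Y → ℂ} {g : Z → Y}
    (hf : BddMeasC f) (hg : Measurable g) :
    BddMeasC (fun x => f (g x)) := ⟨hf.1.comp hg, hf.2.imp fun _ hC _ => hC _⟩

lemma bmC_ofReal {Y : Type} [MeasurableSpace Y] {f : Y → ℝ} (hf : Measurable f) {B : ℝ}
    (hB : ∀ x, |f x| ≤ B) : BddMeasC (fun x => (f x : ℂ)) :=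
  ⟨by fun_prop, B, fun x => by rw [Complex.norm_real]; exact hB x⟩

lemma bmC_ind {Y : Type} [MeasurableSpace Y] {A : Set Y} (hA : MeasurableSet A) :
    BddMeasC (A.indicator (fun _ => (1:ℂ))) :=
  ⟨measurable_const.indicator hA, 1, fun x => by by_cases hx : x ∈ A <;> simp [hx]⟩

lemma cocycle_all {X : Type} [MeasurableSpace X] {r : X → X} (hr : Measurable r) {μ : Measure X}
    {μhat : Measure (Xinf r)} {W : X → ℝ} (hW : Measurable W)
    (hW0 : ∀ x, 0 ≤ W x) {B : ℝ} (hB : ∀ x, |W x| ≤ B)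
    (H : μhat = (μhat.withDensity (fun x => ENNReal.ofReal (W (theta r 0 x)))).map (rhat r))
    {f : Xinf r → ℂ} (hf : IsCocycle r μhat f) {h₀ : X → ℂ} (hc : CondExpRel r μ μhat f h₀)
    (n : ℕ) : ∀ {g : X → ℂ}, BddMeasC g →
    ∫ x, g (theta r n x) * f x ∂μhat = ∫ x, (Wn r W n x : ℂ) * g x * h₀ x ∂μ := by
  induction n with
  | zero =>
    intro g hg
    simpa [Wn] using hc g hg
  | succ n ih =>
    intro g hg
    rw [cocycle_succ hr hW hW0 H hf (u := fun x => g (theta r (n+1) x))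
      (hg.1.comp (theta_meas r _))]
    have hW' : BddMeasC (fun x => (W (r^[n] x) : ℂ)) :=
      bmC_ofReal (hW.comp (hr.iterate n)) (fun x => hB _)
    have := ih (bmC_mul hW' hg)
    simp only [theta_iter0 r] at this
    simp only [theta_rhat_succ]
    rw [this]
    refine integral_congr_ae (Eventually.of_forall fun x => ?_)
    simp only [Wn_succ]
    push_cast; ring

lemma converse_int {X : Type} [MeasurableSpace X] {r : X → X} {μ : Measure X}
    [IsProbabilityMeasure μ]
    {μhat : Measure (Xinf r)} [IsFiniteMeasure μhat]
    {f : Xinf r → ℂ} {C : ℝ} (hC : ∀ x, ‖f x‖ ≤ C) {h₀ : X → ℂ}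
    (hm : Measurable h₀) (hc : CondExpRel r μ μhat f h₀) : Integrable h₀ μ := by
  -- test against truncated phases
  have key : ∀ N : ℕ, ∫ x, ({x | ‖h₀ x‖ ≤ N}.indicator (fun x => ‖h₀ x‖) x) ∂μ
      ≤ C * μhat.real Set.univ := by
    intro N
    have hS : MeasurableSet {x | ‖h₀ x‖ ≤ N} := measurableSet_le (by fun_prop) (by fun_prop)
    let g : X → ℂ := {x | ‖h₀ x‖ ≤ N}.indicator (fun x => (starRingEnd ℂ) (h₀ x) / ‖h₀ x‖)
    have hg1 : ∀ x, ‖g x‖ ≤ 1 := by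
      intro x
      by_cases hx : ‖h₀ x‖ ≤ N
      · simp [g, hx, div_self_le_one]
      · simp [g, hx]
    have hg : BddMeasC g := ⟨Measurable.indicator (by
      have : Measurable (fun x => (starRingEnd ℂ) (h₀ x)) :=
        Complex.continuous_conj.measurable.comp hm
      fun_prop) hS, 1, hg1⟩
    have e := hc g hg
    have e2 : ∀ x, g x * h₀ x = (({x | ‖h₀ x‖ ≤ N}.indicator (fun x => ‖h₀ x‖) x : ℝ) : ℂ) := by
      intro x
      by_cases hx : ‖h₀ x‖ ≤ N
      · simp only [g, Set.mem_ofPred_eq, hx, Set.indicator_of_mem]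
        by_cases h0 : h₀ x = 0
        · simp [h0]
        · have : (‖h₀ x‖ : ℂ) ≠ 0 := by simpa using h0
          rw [div_mul_eq_mul_div, mul_comm, Complex.mul_conj, Complex.normSq_eq_norm_sq]
          push_cast
          field_simp
      · simp [g, hx]
    simp_rw [e2] at e
    rw [integral_complex_ofReal] at e
    have e3 := norm_integral_le_of_norm_le_const (μ := μhat) (C := C)
      (f := fun xh => g (theta r 0 xh) * f xh) (Eventually.of_forall fun x => by
        rw [norm_mul]
        calc _ ≤ 1 * ‖f x‖ := by gcongr; exact hg1 _
          _ ≤ C := by rw [one_mul]; exact hC x)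
    rw [e, Complex.norm_real] at e3
    exact (le_abs_self _).trans e3
  have hnorm : Integrable (fun x => ‖h₀ x‖) μ := by
    refine integrable_of_tendsto' (G := fun N : ℕ =>
      {x | ‖h₀ x‖ ≤ N}.indicator (fun x => ‖h₀ x‖)) (Eventually.of_forall fun x => ?_)
      (fun N => ?_) ?_
    · refine tendsto_const_nhds.congr' ?_
      obtain ⟨n, hn⟩ := exists_nat_ge ‖h₀ x‖
      filter_upwards [eventually_ge_atTop n] with m hm
      have : ‖h₀ x‖ ≤ m := hn.trans (by exact_mod_cast hm)
      simp [this]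
    · exact (Measurable.indicator (by fun_prop)
        (measurableSet_le (by fun_prop) (by fun_prop))).aestronglyMeasurable
    · refine ne_top_of_le_ne_top (b := ENNReal.ofReal (C * μhat.real Set.univ))
        ENNReal.ofReal_ne_top ?_
      refine (liminf_le_liminf (Eventually.of_forall fun N => ?_)).trans
        (le_of_eq (liminf_const _))
      refine le_trans (le_of_eq ?_) (ENNReal.ofReal_le_ofReal (key N))
      have hnn : ∀ x, 0 ≤ {x | ‖h₀ x‖ ≤ N}.indicator (fun x => ‖h₀ x‖) x := fun x =>
        Set.indicator_nonneg (fun _ _ => norm_nonneg _) _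
      rw [ofReal_integral_eq_lintegral_ofReal _ (Eventually.of_forall hnn)]
      · exact lintegral_congr fun x => Real.enorm_eq_ofReal (hnn x)
      · refine Integrable.of_bound (C := N) (Measurable.indicator (by fun_prop)
          (measurableSet_le (by fun_prop) (by fun_prop))).aestronglyMeasurable
          (Eventually.of_forall fun x => ?_)
        by_cases hx : ‖h₀ x‖ ≤ N <;> simp [hx]
  exact (integrable_norm_iff hm.aestronglyMeasurable).1 hnorm


/-- The filtration generated by the coordinates. -/
def filt {X : Type} [MeasurableSpace X] {r : X → X} (hr : Measurable r) :
    Filtration ℕ (inferInstance : MeasurableSpace (Xinf r)) where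
  seq n := MeasurableSpace.comap (theta r n) inferInstance
  mono' := by
    refine monotone_nat_of_le_succ fun n => ?_
    rintro _ ⟨A, hA, rfl⟩
    exact ⟨r ⁻¹' A, hr hA, by ext x; simp [theta_succ r]⟩
  le' n := (theta_meas r n).comap_le

lemma conv_real {X : Type} [MeasurableSpace X] {r : X → X} (hr : Measurable r)
    {ν : Measure (Xinf r)} [IsFiniteMeasure ν] {q : X → ℝ} (hq : Measurable q) {C : ℝ}
    (hC : ∀ x, |q x| ≤ C)
    (H : ∀ n (A : Set X), MeasurableSet A → ∫ x in theta r n ⁻¹' A, q (theta r n x) ∂ν =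
      ∫ x in theta r n ⁻¹' A, q (theta r (n+1) x) ∂ν) :
    ∀ᵐ x ∂ν, ∃ c, Tendsto (fun n => q (theta r n x)) atTop (𝓝 c) := by
  have hm : ∀ n, Measurable fun x => q (theta r n x) := fun n => hq.comp (theta_meas r n)
  have hb : ∀ n, ∀ᵐ x ∂ν, ‖q (theta r n x)‖ ≤ C := fun n => Eventually.of_forall fun x => hC _
  have hmart : Martingale (fun n x => q (theta r n x)) (filt hr) ν := by
    refine martingale_of_setIntegral_eq_succ (fun n => ?_)
      (fun n => Integrable.of_bound (hm n).aestronglyMeasurable C (hb n)) ?_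
    · exact (hq.comp (comap_measurable _)).stronglyMeasurable
    · rintro n _ ⟨A, hA, rfl⟩
      exact H n A hA
  refine hmart.submartingale.exists_ae_tendsto_of_bdd
    (R := (ν Set.univ * ENNReal.ofReal C).toNNReal) fun n => ?_
  refine (eLpNorm_le_of_ae_bound (hb n)).trans ?_
  rw [ENNReal.coe_toNNReal (ENNReal.mul_ne_top (measure_ne_top _ _) ENNReal.ofReal_ne_top)]
  simp

lemma set_eq_ind {X : Type} [MeasurableSpace X] {r : X → X}
    {ν : Measure (Xinf r)} {A : Set X} (hA : MeasurableSet A) (n : ℕ) (F : Xinf r → ℂ) :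
    ∫ x in theta r n ⁻¹' A, F x ∂ν =
      ∫ x, A.indicator (fun _ => (1:ℂ)) (theta r n x) * F x ∂ν := by
  rw [← integral_indicator (theta_meas r n hA)]
  refine integral_congr_ae (Eventually.of_forall fun x => ?_)
  by_cases hx : theta r n x ∈ A
  · simp [Set.indicator, hx]
  · simp [Set.indicator, hx]

lemma conv_complex {X : Type} [MeasurableSpace X] {r : X → X} (hr : Measurable r)
    {ν : Measure (Xinf r)} [IsFiniteMeasure ν] {q : X → ℂ} (hq : Measurable q) {C : ℝ}
    (hC : ∀ x, ‖q x‖ ≤ C)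
    (H : ∀ n (g : X → ℂ), BddMeasC g → ∫ x, g (theta r n x) * q (theta r n x) ∂ν =
      ∫ x, g (theta r n x) * q (theta r (n+1) x) ∂ν) :
    ∀ᵐ x ∂ν, ∃ c, Tendsto (fun n => q (theta r n x)) atTop (𝓝 c) := by
  have hi : ∀ n, Integrable (fun x => q (theta r n x)) ν := fun n =>
    Integrable.of_bound (hq.comp (theta_meas r n)).aestronglyMeasurable C
      (Eventually.of_forall fun x => hC _)
  have H' : ∀ n (A : Set X), MeasurableSet A → ∫ x in theta r n ⁻¹' A, q (theta r n x) ∂ν =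
      ∫ x in theta r n ⁻¹' A, q (theta r (n+1) x) ∂ν := by
    intro n A hA
    rw [set_eq_ind hA, set_eq_ind hA]
    exact H n _ (bmC_ind hA)
  have h1 := conv_real hr (ν := ν) (q := fun x => (q x).re) (by fun_prop) (C := C)
    (fun x => (Complex.abs_re_le_norm _).trans (hC x)) (fun n A hA => by
      have := congrArg Complex.re (H' n A hA)
      have a1 := Complex.reCLM.integral_comp_comm ((hi n).integrableOn (s := theta r n ⁻¹' A))
      have a2 := Complex.reCLM.integral_comp_comm ((hi (n+1)).integrableOn (s := theta r n ⁻¹' A))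
      simp only [Complex.reCLM_apply] at a1 a2
      rw [a1, a2, this])
  have h2 := conv_real hr (ν := ν) (q := fun x => (q x).im) (by fun_prop) (C := C)
    (fun x => (Complex.abs_im_le_norm _).trans (hC x)) (fun n A hA => by
      have := congrArg Complex.im (H' n A hA)
      have a1 := Complex.imCLM.integral_comp_comm ((hi n).integrableOn (s := theta r n ⁻¹' A))
      have a2 := Complex.imCLM.integral_comp_comm ((hi (n+1)).integrableOn (s := theta r n ⁻¹' A))
      simp only [Complex.imCLM_apply] at a1 a2
      rw [a1, a2, this])
  filter_upwards [h1, h2] with x ⟨a, ha⟩ ⟨b, hb⟩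
  refine ⟨(a : ℂ) + b * Complex.I, ?_⟩
  have t1 : Tendsto (fun n => ((q (theta r n x)).re : ℂ)) atTop (𝓝 (a : ℂ)) :=
    (Complex.continuous_ofReal.tendsto a).comp ha
  have t2 : Tendsto (fun n => ((q (theta r n x)).im : ℂ)) atTop (𝓝 (b : ℂ)) :=
    (Complex.continuous_ofReal.tendsto b).comp hb
  refine (t1.add (t2.mul_const Complex.I)).congr fun n => ?_
  exact Complex.re_add_im _

/-- A canonical, everywhere bounded and everywhere `r̂`-invariant version of the limit. -/
lemma exists_limit {X : Type} [MeasurableSpace X] {r : X → X}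
    {q : X → ℂ} (hq : Measurable q) {C : ℝ} (hC0 : 0 ≤ C)
    (hC : ∀ x, ‖q x‖ ≤ C) :
    ∃ f : Xinf r → ℂ, Measurable f ∧ (∀ x, ‖f x‖ ≤ C) ∧ (∀ x, f (rhat r x) = f x) ∧
      ∀ x, (∃ c, Tendsto (fun n => q (theta r n x)) atTop (𝓝 c)) →
        Tendsto (fun n => q (theta r n x)) atTop (𝓝 (f x)) := by
  classical
  have hm : ∀ n, Measurable fun x : Xinf r => q (theta r n x) := fun n => hq.comp (theta_meas r n)
  let S : Set (Xinf r) := {x | ∃ c, Tendsto (fun n => q (theta r n x)) atTop (𝓝 c)}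
  have hS : MeasurableSet S := measurableSet_exists_tendsto hm
  let f : Xinf r → ℂ := fun x => if hx : x ∈ S then hx.choose else 0
  have hf : ∀ x, x ∈ S → Tendsto (fun n => q (theta r n x)) atTop (𝓝 (f x)) := by
    intro x hx
    simp only [f, dif_pos hx]
    exact hx.choose_spec
  have hf0 : ∀ x, x ∉ S → f x = 0 := fun x hx => by simp only [f, dif_neg hx]
  have hsh : ∀ x c, Tendsto (fun n => q (theta r n (rhat r x))) atTop (𝓝 c) ↔
      Tendsto (fun n => q (theta r n x)) atTop (𝓝 c) := by
    intro x c
    rw [← tendsto_add_atTop_iff_nat (f := fun n => q (theta r n (rhat r x))) 1]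
    rfl
  refine ⟨f, ?_, ?_, ?_, hf⟩
  · refine measurable_of_tendsto_metrizable
      (f := fun n => S.indicator (fun x => q (theta r n x))) (fun n => (hm n).indicator hS) ?_
    rw [tendsto_pi_nhds]
    intro x
    by_cases hx : x ∈ S
    · simpa [hx] using hf x hx
    · simp [hx, hf0 x hx]
  · intro x
    by_cases hx : x ∈ S
    · exact le_of_tendsto (hf x hx).norm (Eventually.of_forall fun n => hC _)
    · simpa [hf0 x hx] using hC0
  · intro x
    by_cases hx : x ∈ S
    · have hx' : rhat r x ∈ S := ⟨f x, (hsh x _).2 (hf x hx)⟩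
      exact tendsto_nhds_unique ((hsh x _).1 (hf _ hx')) (hf x hx)
    · have hx' : rhat r x ∉ S := fun ⟨c, hc⟩ => hx ⟨c, (hsh x c).1 hc⟩
      rw [hf0 _ hx, hf0 _ hx']

end HC
/-- Theorem 4.18 (2)&(3): for a Perron–Ruelle–Frobenius pair `(m₀, h)` with `m₀` non-singular,
every measurable harmonic function `h₀` (i.e. `R h₀ = h₀`) with `|h₀|² ≤ c h²` corresponds to a
unique cocycle `f` with `h₀ = E₀(f) h`, given by `f = lim_n (h₀/h)∘θ_n` pointwise `μ̂`-a.e. and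
in every `L^p(μ̂)`, `1 ≤ p < ∞`; conversely every cocycle gives a harmonic function. -/
theorem harmonic_iff_cocycle
    (X : Type) [MeasurableSpace X] (r : X → X) (hr : Measurable r)
    (hsur : Function.Surjective r) (hfin : ∀ x, (r ⁻¹' {x}).Finite)
    (μ : Measure X) [IsProbabilityMeasure μ] (hinv : StronglyInvariant r μ)
    (m₀ : X → ℂ) (hm₀ : BddMeasC m₀)
    (h : X → ℝ) (hmeas : Measurable h) (hint : Integrable h μ) (hpos : ∀ x, 0 ≤ h x)
    (hfix : ∀ᵐ x ∂μ, ruelle r (fun y => ‖m₀ y‖ ^ 2) h x = h x)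
    (hns : μ {x | m₀ x = 0} = 0)
    (μhat : Measure (Xinf r))
    (hμhat : ∀ (n : ℕ) (E : Set X), MeasurableSet E →
      μhat (theta r n ⁻¹' E) =
        ENNReal.ofReal (∫ x, (ruelle r fun y => ‖m₀ y‖ ^ 2)^[n] (E.indicator h) x ∂μ)) :
    (∀ h₀ : X → ℂ, Measurable h₀ →
      (∀ x, ruelleC r (fun y => ‖m₀ y‖ ^ 2) h₀ x = h₀ x) →
      (∃ c : ℝ, 0 ≤ c ∧ ∀ x, ‖h₀ x‖ ^ 2 ≤ c * h x ^ 2) →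
      ∃ f : Xinf r → ℂ, IsCocycle r μhat f ∧ CondExpRel r μ μhat f h₀ ∧
        (∀ f' : Xinf r → ℂ, IsCocycle r μhat f' → CondExpRel r μ μhat f' h₀ →
          f' =ᵐ[μhat] f) ∧
        (∀ᵐ xh ∂μhat, Tendsto (fun n => h₀ (theta r n xh) / (h (theta r n xh) : ℂ))
          atTop (𝓝 (f xh))) ∧
        (∀ p : ℝ, 1 ≤ p → Tendsto
          (fun n => ∫ xh, ‖h₀ (theta r n xh) / (h (theta r n xh) : ℂ) - f xh‖ ^ p ∂μhat)
          atTop (𝓝 0))) ∧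
    (∀ f : Xinf r → ℂ, IsCocycle r μhat f →
      ∀ h₀ : X → ℂ, Measurable h₀ → CondExpRel r μ μhat f h₀ →
        ∀ᵐ x ∂μ, ruelleC r (fun y => ‖m₀ y‖ ^ 2) h₀ x = h₀ x) := by
  obtain ⟨C₀, hC₀⟩ := hm₀.2
  set W : X → ℝ := fun y => ‖m₀ y‖ ^ 2 with hWdef
  have hW : Measurable W := by have := hm₀.1; fun_prop
  have hW0 : ∀ x, 0 ≤ W x := fun x => by positivity
  have hB : ∀ x, |W x| ≤ C₀ ^ 2 := fun x => by
    rw [abs_of_nonneg (hW0 x)]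
    exact pow_le_pow_left₀ (norm_nonneg _) (hC₀ x) 2
  have H := HC.map_theta hr hsur hfin hinv hW hB hW0 hint hpos μhat hμhat
  have hfinm : IsFiniteMeasure μhat := ⟨by
    have := hμhat 0 Set.univ MeasurableSet.univ
    rw [Set.preimage_univ] at this
    rw [this]; exact ENNReal.ofReal_lt_top⟩
  have hrh := HC.rhat_inv hr hW hW0 hmeas H
  constructor
  · rintro h₀ hm hharm ⟨c, hc0, hc⟩
    have hle : ∀ x, ‖h₀ x‖ ≤ √c * h x := by
      intro x
      apply le_of_sq_le_sq _ (mul_nonneg (Real.sqrt_nonneg _) (hpos x))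
      rw [mul_pow, Real.sq_sqrt hc0]
      exact hc x
    have hi : Integrable h₀ μ := (hint.const_mul √c).mono' hm.aestronglyMeasurable
      (Eventually.of_forall hle)
    let q : X → ℂ := fun x => h₀ x / (h x : ℂ)
    have hq : Measurable q := by fun_prop
    have hqC : ∀ x, ‖q x‖ ≤ √c := by
      intro x
      simp only [q, norm_div, Complex.norm_real, Real.norm_of_nonneg (hpos x)]
      exact div_le_of_le_mul₀ (hpos x) (Real.sqrt_nonneg _) (hle x)
    have hhq : ∀ x, (h x : ℂ) * q x = h₀ x := by
      intro x
      by_cases h0 : h x = 0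
      · have := hle x
        rw [h0, mul_zero] at this
        simp [h0, norm_le_zero_iff.1 this]
      · have : (h x : ℂ) ≠ 0 := by exact_mod_cast h0
        simp only [q]
        field_simp
    have fact1 : ∀ n (g : X → ℂ), BddMeasC g →
        ∫ x, g (theta r n x) * q (theta r n x) ∂μhat =
          ∫ x, (HC.Wn r W n x : ℂ) * g x * h₀ x ∂μ := by
      intro n g hg
      rw [HC.int_theta ((HC.Wn_meas hr hW n).mul hmeas)
        (fun x => mul_nonneg (HC.Wn_nonneg r hW0 n x) (hpos x)) (HC.map_eq n (H n))
        (G := fun x => g x * q x) (hg.1.mul hq)]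
      refine integral_congr_ae (Eventually.of_forall fun x => ?_)
      simp only [Pi.mul_apply]
      rw [← hhq x]
      push_cast; ring
    have fact2 : ∀ n (g : X → ℂ), BddMeasC g →
        ∫ x, g (theta r n x) * q (theta r n x) ∂μhat =
          ∫ x, g (theta r n x) * q (theta r (n+1) x) ∂μhat := by
      intro n g hg
      rw [fact1 n g hg]
      have e := fact1 (n+1) (fun x => g (r x)) (HC.bmC_comp hg hr)
      simp only [HC.theta_succ r] at e
      rw [e]
      have e2 := (HC.ruelleC_main hr hsur hfin hinv hW hB
        (HC.bmC_mul (HC.bmC_ofReal (HC.Wn_meas hr hW n) (HC.Wn_bdd r hB n)) hg) hi).2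
      simp only [hharm] at e2
      rw [e2]
      refine integral_congr_ae (Eventually.of_forall fun x => ?_)
      simp only [HC.Wn_succ']
      push_cast; ring
    have hconv := HC.conv_complex hr hq hqC fact2
    obtain ⟨f, hfm, hfb, hfr, hft⟩ := HC.exists_limit (r := r) hq (Real.sqrt_nonneg c) hqC
    have hlim : ∀ᵐ x ∂μhat, Tendsto (fun n => q (theta r n x)) atTop (𝓝 (f x)) := by
      filter_upwards [hconv] with x hx using hft x hx
    have hfi : Integrable f μhat := Integrable.of_bound hfm.aestronglyMeasurable √c
      (Eventually.of_forall hfb)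
    have hqm : ∀ n, Measurable fun x => q (theta r n x) := fun n => hq.comp (HC.theta_meas r n)
    have hcoc : IsCocycle r μhat f := ⟨hfm, ⟨_, hfb⟩, Eventually.of_forall hfr⟩
    have hcond : CondExpRel r μ μhat f h₀ := by
      intro g hg
      obtain ⟨hgm, D, hD⟩ := id hg
      have hconst : ∀ n, ∫ x, g (theta r 0 x) * q (theta r n x) ∂μhat = ∫ x, g x * h₀ x ∂μ := by
        intro n
        induction n with
        | zero => simpa [HC.Wn] using fact1 0 g hg
        | succ n ih =>
          rw [← ih]
          have := fact2 n (fun x => g (r^[n] x)) (HC.bmC_comp hg (hr.iterate n))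
          simp only [HC.theta_iter0 r] at this
          exact this.symm
      have t := tendsto_integral_of_dominated_convergence (μ := μhat)
        (F := fun n x => g (theta r 0 x) * q (theta r n x))
        (f := fun x => g (theta r 0 x) * f x) (fun _ => D * √c)
        (fun n => ((hgm.comp (HC.theta_meas r 0)).mul (hqm n)).aestronglyMeasurable)
        (integrable_const _)
        (fun n => Eventually.of_forall fun x => by
          rw [norm_mul]
          exact mul_le_mul (hD _) (hqC _) (norm_nonneg _) ((norm_nonneg _).trans (hD (theta r 0 x))))
        (by filter_upwards [hlim] with x hx using hx.const_mul _)
      simp only [hconst] at t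
      exact tendsto_nhds_unique t tendsto_const_nhds
    refine ⟨f, hcoc, hcond, ?_, hlim, ?_⟩
    · intro f' hf' hc'
      obtain ⟨C', hC'⟩ := hf'.2.1
      refine HC.ae_eq_of_cyl hr (Integrable.of_bound hf'.1.aestronglyMeasurable C'
        (Eventually.of_forall hC')) hfi fun n A hA => ?_
      rw [HC.set_eq_ind hA, HC.set_eq_ind hA,
        HC.cocycle_all hr hW hW0 hB hrh hf' hc' n (HC.bmC_ind hA),
        HC.cocycle_all hr hW hW0 hB hrh hcoc hcond n (HC.bmC_ind hA)]
    · intro p hp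
      have hp0 : 0 < p := by linarith
      have t := tendsto_integral_of_dominated_convergence (μ := μhat)
        (F := fun n x => ‖q (theta r n x) - f x‖ ^ p)
        (f := fun x => 0) (fun _ => (√c + √c) ^ p)
        (fun n => ((((hqm n).sub hfm).norm).pow_const p).aestronglyMeasurable)
        (integrable_const _)
        (fun n => Eventually.of_forall fun x => by
          rw [Real.norm_of_nonneg (Real.rpow_nonneg (norm_nonneg _) _)]
          exact Real.rpow_le_rpow (norm_nonneg _)
            ((norm_sub_le _ _).trans (add_le_add (hqC _) (hfb _))) hp0.le)
        (by
          filter_upwards [hlim] with x hx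
          have h1 : Tendsto (fun n => ‖q (theta r n x) - f x‖) atTop (𝓝 0) :=
            tendsto_iff_norm_sub_tendsto_zero.1 hx
          have h2 := h1.rpow_const (p := p) (Or.inr hp0.le)
          rwa [Real.zero_rpow hp0.ne'] at h2)
      simpa using t
  · intro f hf h₀ hm hc
    obtain ⟨C, hC⟩ := hf.2.1
    have hi := HC.converse_int hC hm hc
    have h1 := HC.ruelleC_main hr hsur hfin hinv hW hB (u := fun _ => 1)
      ⟨measurable_const, 1, by simp⟩ hi
    simp only [one_mul] at h1
    refine Integrable.ae_eq_of_forall_setIntegral_eq _ _ h1.1 hi fun s hs _ => ?_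
    have hind : ∀ F : X → ℂ, ∫ x in s, F x ∂μ = ∫ x, s.indicator (fun _ => (1:ℂ)) x * F x ∂μ := by
      intro F
      rw [← integral_indicator hs]
      refine integral_congr_ae (Eventually.of_forall fun x => ?_)
      by_cases hx : x ∈ s <;> simp [hx]
    have hg := HC.bmC_ind hs
    rw [hind, hind, (HC.ruelleC_main hr hsur hfin hinv hW hB hg hi).2]
    have e1 := hc _ (HC.bmC_mul (HC.bmC_ofReal hW hB) (HC.bmC_comp hg hr))
    rw [← e1, ← hc _ hg, HC.cocycle_succ hr hW hW0 hrh hf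
      (u := fun x => s.indicator (fun _ => (1:ℂ)) (theta r 0 x))
      (hg.1.comp (HC.theta_meas r 0))]
    simp only [HC.theta_rhat_zero]
end

section
/- Let X be a compact metric space, r : X → X a continuous map that is onto and finite-to-one, and V : X → [0,∞) continuous. Set V^{(n)} := V·(V∘r)⋯(V∘r^{n-1}). Assume there exist a Borel measure ν on X and numbers 0 < a < b such that a ≤ ν(X) ≤ b and a ≤ ∫_X V^{(n)} dν ≤ b for all n ∈ ℕ. Then there exists a nonzero Borel measure μ₀ on X satisfying dμ₀ = (V dμ₀)∘r⁻¹ (i.e., ∫_X V·(f∘r) dμ₀ = ∫_X f dμ₀ for all bounded measurable f), and consequently there exists a nonzero V-quasi-invariant measure μ̂ on (X_∞(r), 𝔅_∞). -/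
open MeasureTheory
open scoped ENNReal

/-- The inverse of the induced automorphism `r̂`: `(x₀,x₁,…) ↦ (x₁,x₂,…)`.
Note `(μ̂ ∘ r̂)(E) = μ̂(r̂(E)) = (μ̂.map rhatInv)(E)`. -/
def rhatInv {X : Type} (r : X → X) (xh : Xinf r) : Xinf r :=
  ⟨fun n => (xh : ℕ → X) (n + 1), fun n => xh.2 (n + 1)⟩

/-- Riesz–Markov–Kakutani on a compact space, for functionals on `C(Y, ℝ)`. -/
theorem exists_measure_of_positive {Y : Type} [TopologicalSpace Y] [CompactSpace Y] [T2Space Y]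
    [MeasurableSpace Y] [BorelSpace Y] (L : C(Y, ℝ) →ₗ[ℝ] ℝ)
    (hL : ∀ F : C(Y, ℝ), 0 ≤ F → 0 ≤ L F) :
    ∃ μ : Measure Y, IsFiniteMeasure μ ∧ ∀ F : C(Y, ℝ), ∫ y, F y ∂μ = L F := by
  let L' : CompactlySupportedContinuousMap Y ℝ →ₗ[ℝ] ℝ :=
    { toFun := fun f => L f.toContinuousMap
      map_add' := fun f g => L.map_add f.toContinuousMap g.toContinuousMap
      map_smul' := fun c f => L.map_smul c f.toContinuousMap }
  let P : CompactlySupportedContinuousMap Y ℝ →ₚ[ℝ] ℝ :=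
    PositiveLinearMap.mk₀ L' (fun f hf => hL f.toContinuousMap (fun y => hf y))
  refine ⟨RealRMK.rieszMeasure P, inferInstance, fun F => ?_⟩
  exact RealRMK.integral_rieszMeasure P (CompactlySupportedContinuousMap.continuousMapEquiv F)

/-- Lifting a finite measure through a continuous surjection, as a positive functional. -/
theorem exists_lift_functional {X Y : Type} [TopologicalSpace Y] [CompactSpace Y]
    [TopologicalSpace X] [CompactSpace X] [MeasurableSpace X] [BorelSpace X]
    (p : C(Y, X)) (hp : Function.Surjective p) (ν : Measure X) [IsFiniteMeasure ν] :
    ∃ L : C(Y, ℝ) →ₗ[ℝ] ℝ, (∀ F : C(Y, ℝ), 0 ≤ F → 0 ≤ L F) ∧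
      ∀ g : C(X, ℝ), L (g.comp p) = ∫ x, g x ∂ν := by
  have hint : ∀ g : C(X, ℝ), Integrable (fun x => g x) ν := fun g =>
    (BoundedContinuousFunction.mkOfCompact g).integrable ν
  let I : C(X, ℝ) →ₗ[ℝ] ℝ :=
    { toFun := fun g => ∫ x, g x ∂ν
      map_add' := fun f g => integral_add (hint f) (hint g)
      map_smul' := fun c g => integral_const_mul c _ }
  let R : C(X, ℝ) →ₗ[ℝ] C(Y, ℝ) :=
    { toFun := fun g => g.comp p
      map_add' := fun f g => rfl
      map_smul' := fun c g => rfl }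
  have hR : Function.Injective R := by
    intro f g h
    ext x
    obtain ⟨y, rfl⟩ := hp x
    exact congrArg (fun F : C(Y, ℝ) => F y) h
  let e := LinearEquiv.ofInjective R hR
  let f : C(Y, ℝ) →ₗ.[ℝ] ℝ := ⟨LinearMap.range R, I ∘ₗ e.symm.toLinearMap⟩
  let s : PointedCone ℝ C(Y, ℝ) :=
    { carrier := {F | 0 ≤ F}
      add_mem' := fun {F G} hF hG y => add_nonneg (hF y) (hG y)
      zero_mem' := le_refl (0 : C(Y, ℝ))
      smul_mem' := fun c F hF y => mul_nonneg c.2 (hF y) }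
  have hfe : ∀ g, f (e g) = I g := fun g => by
    change I (e.symm (e g)) = I g
    rw [e.symm_apply_apply]
  obtain ⟨L, hL1, hL2⟩ := riesz_extension s f (by
      intro x hx
      obtain ⟨g, rfl⟩ := e.surjective x
      rw [hfe]
      refine integral_nonneg fun z => ?_
      obtain ⟨y, rfl⟩ := hp z
      exact hx y) (by
      intro F
      refine ⟨e (ContinuousMap.const X ‖F‖), fun y => ?_⟩
      change 0 ≤ ‖F‖ + F y
      have := F.neg_norm_le_apply y
      linarith)
  refine ⟨L, fun F hF => hL2 F hF, fun g => ?_⟩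
  exact (hL1 (e g)).trans (hfe g)

/-- Krylov–Bogoliubov averaging on the level of functionals. -/
theorem exists_invariant_functional {Y : Type} [TopologicalSpace Y] [CompactSpace Y]
    (L : C(Y, ℝ) →ₗ[ℝ] ℝ) (hL : ∀ F : C(Y, ℝ), 0 ≤ F → 0 ≤ L F)
    (T : C(Y, ℝ) →ₗ[ℝ] C(Y, ℝ)) (hT : ∀ F : C(Y, ℝ), 0 ≤ F → 0 ≤ T F)
    (a b : ℝ) (hab : ∀ n : ℕ, a ≤ L ((T ^ n) 1) ∧ L ((T ^ n) 1) ≤ b) :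
    ∃ P : C(Y, ℝ) →ₗ[ℝ] ℝ, (∀ F : C(Y, ℝ), 0 ≤ F → 0 ≤ P F) ∧ (∀ F, P (T F) = P F) ∧
      a ≤ P 1 := by
  have hTn : ∀ (n : ℕ) (F : C(Y, ℝ)), 0 ≤ F → 0 ≤ (T ^ n) F := by
    intro n
    induction n with
    | zero => intro F hF; simpa using hF
    | succ n ih => intro F hF; rw [pow_succ]; exact ih _ (hT F hF)
  have hbd : ∀ (n : ℕ) (F : C(Y, ℝ)), |L ((T ^ n) F)| ≤ ‖F‖ * b := by
    intro n F
    have h1 : 0 ≤ L ((T ^ n) (‖F‖ • 1 - F)) := hL _ (hTn n _ (fun y => by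
      change 0 ≤ ‖F‖ * 1 - F y
      have := F.apply_le_norm y
      linarith))
    have h2 : 0 ≤ L ((T ^ n) (‖F‖ • 1 + F)) := hL _ (hTn n _ (fun y => by
      change 0 ≤ ‖F‖ * 1 + F y
      have := F.neg_norm_le_apply y
      linarith))
    simp only [map_sub, map_add, map_smul, smul_eq_mul] at h1 h2
    have := mul_le_mul_of_nonneg_left (hab n).2 (norm_nonneg F)
    rw [abs_le]
    constructor <;> linarith
  let A : ℕ → C(Y, ℝ) → ℝ := fun N F =>
    ((N : ℝ) + 1)⁻¹ * ∑ n ∈ Finset.range (N + 1), L ((T ^ n) F)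
  have hpos : ∀ N : ℕ, (0 : ℝ) < (N : ℝ) + 1 := fun N => by positivity
  have hA : ∀ N F, A N F ∈ Set.Icc (-(‖F‖ * b)) (‖F‖ * b) := by
    intro N F
    rw [Set.mem_Icc, ← abs_le, abs_mul, abs_of_pos (inv_pos.2 (hpos N)),
      inv_mul_le_iff₀ (hpos N)]
    refine (Finset.abs_sum_le_sum_abs _ _).trans ((Finset.sum_le_sum fun n _ => hbd n F).trans ?_)
    simp
  have hlim : ∀ F, ∃ l, Filter.Tendsto (fun N => A N F) (Filter.hyperfilter ℕ) (nhds l) := by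
    intro F
    obtain ⟨l, -, hl⟩ := (isCompact_Icc (a := -(‖F‖ * b)) (b := ‖F‖ * b)).ultrafilter_le_nhds
      ((Filter.hyperfilter ℕ).map fun N => A N F) (by
        rw [Filter.le_principal_iff]
        exact Filter.Eventually.of_forall (f := (Filter.hyperfilter ℕ : Filter ℕ))
          (fun N => hA N F))
    exact ⟨l, hl⟩
  choose P hP using hlim
  refine ⟨⟨⟨P, fun F G => ?_⟩, fun c F => ?_⟩, fun F hF => ?_, fun F => ?_, ?_⟩
  · refine tendsto_nhds_unique (hP (F + G)) (((hP F).add (hP G)).congr fun N => ?_)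
    simp only [A, map_add, Finset.sum_add_distrib, mul_add]
  · refine tendsto_nhds_unique (hP (c • F)) (((hP F).const_mul c).congr fun N => ?_)
    simp only [A, map_smul, smul_eq_mul, ← Finset.mul_sum]
    ring
  · refine ge_of_tendsto' (hP F) fun N => ?_
    exact mul_nonneg (inv_pos.2 (hpos N)).le (Finset.sum_nonneg fun n _ => hL _ (hTn n F hF))
  · have hdiff : Filter.Tendsto (fun N => A N (T F) - A N F) Filter.atTop (nhds 0) := by
      have h0 : Filter.Tendsto (fun N : ℕ => (1 / ((N : ℝ) + 1)) * (2 * (‖F‖ * b)))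
          Filter.atTop (nhds 0) := by
        simpa using (tendsto_one_div_add_atTop_nhds_zero_nat (𝕜 := ℝ)).mul_const (2 * (‖F‖ * b))
      refine squeeze_zero_norm (fun N => ?_) h0
      have hs : ∑ n ∈ Finset.range (N + 1), L ((T ^ n) (T F)) -
          ∑ n ∈ Finset.range (N + 1), L ((T ^ n) F) = L ((T ^ (N + 1)) F) - L ((T ^ 0) F) := by
        rw [← Finset.sum_sub_distrib, ← Finset.sum_range_sub (fun n => L ((T ^ n) F))]
        refine Finset.sum_congr rfl fun n _ => ?_
        rw [pow_succ]
        rfl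
      have : A N (T F) - A N F = (1 / ((N : ℝ) + 1)) * (L ((T ^ (N + 1)) F) - L ((T ^ 0) F)) := by
        rw [← hs]; simp only [A]; ring
      rw [this, Real.norm_eq_abs, abs_mul, abs_of_pos (one_div_pos.2 (hpos N))]
      refine mul_le_mul_of_nonneg_left ?_ (one_div_pos.2 (hpos N)).le
      refine (abs_sub _ _).trans ?_
      have := hbd (N + 1) F
      have := hbd 0 F
      linarith
    have h1 := hdiff.mono_left Nat.hyperfilter_le_atTop
    have h2 := tendsto_nhds_unique h1 ((hP (T F)).sub (hP F))
    change P (T F) = P F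
    linarith
  · refine ge_of_tendsto' (hP 1) fun N => ?_
    simp only [A]
    rw [le_inv_mul_iff₀ (hpos N)]
    refine le_trans ?_ (Finset.sum_le_sum fun n _ => (hab n).1)
    simp

/-- Theorem 5.9: if `V : X → [0,∞)` is continuous on the compact metric space `X` and some
measure `ν` satisfies `a ≤ ν(X) ≤ b` and `a ≤ ∫ V^{(n)} dν ≤ b` for all `n` (where
`V^{(n)} = V·(V∘r)⋯(V∘r^{n-1})`), then there is a nonzero measure `μ₀` with
`dμ₀ = (V dμ₀)∘r⁻¹`, and hence a nonzero `V`-quasi-invariant measure `μ̂` on `X_∞(r)`. -/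
theorem exists_fixed_point_measure_of_bounds
    (X : Type) [MetricSpace X] [CompactSpace X] [MeasurableSpace X] [BorelSpace X]
    (r : X → X) (hr : Continuous r)
    (hsur : Function.Surjective r) (hfin : ∀ x, (r ⁻¹' {x}).Finite)
    (V : X → ℝ) (hV : Continuous V) (hVpos : ∀ x, 0 ≤ V x)
    (ν : Measure X) [IsFiniteMeasure ν] (a b : ℝ) (ha : 0 < a) (hab : a < b)
    (hν : a ≤ (ν Set.univ).toReal ∧ (ν Set.univ).toReal ≤ b)
    (hbound : ∀ n : ℕ,
      a ≤ ∫ x, (∏ k ∈ Finset.range n, V (r^[k] x)) ∂ν ∧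
      ∫ x, (∏ k ∈ Finset.range n, V (r^[k] x)) ∂ν ≤ b) :
    ∃ μ₀ : Measure X, IsFiniteMeasure μ₀ ∧ μ₀ ≠ 0 ∧
      (∀ f : X → ℝ, BddMeasurable f → ∫ x, V x * f (r x) ∂μ₀ = ∫ x, f x ∂μ₀) ∧
      ∃ μhat : Measure (Xinf r), μhat ≠ 0 ∧
        μhat.map (rhatInv r) =
          μhat.withDensity fun xh => ENNReal.ofReal (V (theta r 0 xh)) := by
  have hclosed : IsClosed (Xinf r) := by
    have : Xinf r = ⋂ n, {x : ℕ → X | r (x (n + 1)) = x n} := by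
      ext x; simp [Xinf]
    rw [this]
    exact isClosed_iInter fun n =>
      isClosed_eq (hr.comp (continuous_apply _)) (continuous_apply _)
  have : CompactSpace (Xinf r) := isCompact_iff_compactSpace.1 hclosed.isCompact
  have hθ : Continuous (theta r 0) := (continuous_apply 0).comp continuous_subtype_val
  have hsc : Continuous (rhatInv r) :=
    Continuous.subtype_mk (f := fun (xh : Xinf r) (n : ℕ) => (xh : ℕ → X) (n + 1))
      (continuous_pi fun n => (continuous_apply (n + 1)).comp continuous_subtype_val)
      (fun xh n => xh.2 (n + 1))
  have hθsur : Function.Surjective (theta r 0) := by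
    intro x
    obtain ⟨g, hg⟩ := hsur.hasRightInverse
    refine ⟨⟨fun n => g^[n] x, fun n => ?_⟩, rfl⟩
    change r (g^[n + 1] x) = g^[n] x
    rw [Function.iterate_succ_apply', hg]
  let rhat : C(Xinf r, Xinf r) :=
    ⟨fun xh => ⟨fun n => r ((xh : ℕ → X) n), fun n => congrArg r (xh.2 n)⟩,
      Continuous.subtype_mk (continuous_pi fun n =>
        hr.comp ((continuous_apply n).comp continuous_subtype_val)) _⟩
  have hinv : ∀ xh, rhatInv r (rhat xh) = xh := fun xh =>
    Subtype.ext (funext fun n => xh.2 n)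
  let p : C(Xinf r, X) := ⟨theta r 0, hθ⟩
  let W : C(Xinf r, ℝ) := ⟨fun xh => V (theta r 0 xh), hV.comp hθ⟩
  let T : C(Xinf r, ℝ) →ₗ[ℝ] C(Xinf r, ℝ) :=
    { toFun := fun F => W * F.comp rhat
      map_add' := fun F G => by ext y; simp [mul_add]
      map_smul' := fun c F => by ext y; simp }
  have hTpos : ∀ F : C(Xinf r, ℝ), 0 ≤ F → 0 ≤ T F := fun F hF y =>
    mul_nonneg (hVpos _) (hF _)
  have hcont : ∀ n : ℕ, Continuous fun x => ∏ k ∈ Finset.range n, V (r^[k] x) := fun n =>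
    continuous_finsetProd _ fun k _ => hV.comp (hr.iterate k)
  have hTn : ∀ n : ℕ, (T ^ n) 1 =
      (⟨fun x => ∏ k ∈ Finset.range n, V (r^[k] x), hcont n⟩ : C(X, ℝ)).comp p := by
    intro n
    induction n with
    | zero => ext y; simp
    | succ n ih =>
      rw [pow_succ', Module.End.mul_apply, ih]
      ext y
      change V (theta r 0 y) * ∏ k ∈ Finset.range n, V (r^[k] (r (theta r 0 y))) =
        ∏ k ∈ Finset.range (n + 1), V (r^[k] (theta r 0 y))
      rw [Finset.prod_range_succ', mul_comm]
      rfl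
  obtain ⟨L, hL, hLν⟩ := exists_lift_functional p hθsur ν
  obtain ⟨P, hP, hPT, hP1⟩ := exists_invariant_functional L hL T hTpos a b (fun n => by
    rw [hTn, hLν]; exact hbound n)
  obtain ⟨μ, hμfin, hμ⟩ := exists_measure_of_positive P hP
  have hμ0 : μ ≠ 0 := by
    rintro rfl
    have := hμ 1
    simp at this
    linarith
  have hWm : Measurable fun xh : Xinf r => ENNReal.ofReal (V (theta r 0 xh)) :=
    (hV.comp hθ).measurable.ennreal_ofReal
  have hwd : ∀ g : Xinf r → ℝ,
      ∫ y, g y ∂(μ.withDensity fun xh => ENNReal.ofReal (V (theta r 0 xh))) =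
        ∫ y, V (theta r 0 y) * g y ∂μ := by
    intro g
    rw [integral_withDensity_eq_integral_toReal_smul hWm
      (Filter.Eventually.of_forall fun _ => ENNReal.ofReal_lt_top)]
    refine integral_congr_ae (Filter.Eventually.of_forall fun y => ?_)
    simp [ENNReal.toReal_ofReal (hVpos _)]
  have hWint : Integrable (fun y => W y) μ :=
    (BoundedContinuousFunction.mkOfCompact W).integrable μ
  have : IsFiniteMeasure (μ.withDensity fun xh => ENNReal.ofReal (V (theta r 0 xh))) :=
    isFiniteMeasure_withDensity_ofReal hWint.2
  have key : μ.map (rhatInv r) =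
      μ.withDensity fun xh => ENNReal.ofReal (V (theta r 0 xh)) := by
    refine ext_of_forall_integral_eq_of_IsFiniteMeasure fun F => ?_
    rw [hwd, integral_map hsc.measurable.aemeasurable
      F.continuous.measurable.aestronglyMeasurable]
    have h1 := hμ ((F.toContinuousMap).comp ⟨rhatInv r, hsc⟩)
    have h2 := hμ (W * F.toContinuousMap)
    have h3 : T ((F.toContinuousMap).comp ⟨rhatInv r, hsc⟩) = W * F.toContinuousMap := by
      ext y
      change V (theta r 0 y) * F (rhatInv r (rhat y)) = V (theta r 0 y) * F y
      rw [hinv]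
    rw [← hPT, h3, ← h2] at h1
    exact h1
  refine ⟨μ.map (theta r 0), inferInstance, ?_, ?_, μ, hμ0, key⟩
  · intro h
    exact hμ0 ((Measure.map_eq_zero_iff hθ.measurable.aemeasurable).1 h)
  · rintro f ⟨hf, -⟩
    have hm1 : Measurable fun x => V x * f (r x) := hV.measurable.mul (hf.comp hr.measurable)
    have hm2 : Measurable fun y => f (r (theta r 0 y)) := hf.comp (hr.comp hθ).measurable
    rw [integral_map hθ.measurable.aemeasurable hf.aestronglyMeasurable,
      integral_map hθ.measurable.aemeasurable
        hm1.aestronglyMeasurable,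
      ← hwd (fun y => f (r (theta r 0 y))), ← key,
      integral_map hsc.measurable.aemeasurable
        hm2.aestronglyMeasurable]
    refine integral_congr_ae (Filter.Eventually.of_forall fun y => ?_)
    exact congrArg f (y.2 0)
end

section
/- Let (X,𝔅) be a measurable space, r : X → X measurable, onto and finite-to-one, and V : X → [0,∞) bounded and measurable. Let μ₀ be a measure on (X,𝔅) with the fixed-point property ∫_X V·(f∘r) dμ₀ = ∫_X f dμ₀ for all f ∈ L^∞(X,μ₀). Let Δ : X → [0,1] be the associated function with Σ_{r(y)=x} Δ(y) = 1 μ₀-a.e. and ∫ V f dμ₀ = ∫ Σ_{r(y)=x} Δ(y) f(y) dμ₀(x), and let μ̂ be the unique V-quasi-invariant measure on (X_∞(r),𝔅_∞) with μ̂∘θ₀⁻¹ = μ₀. For each x₀ ∈ X let P_{x₀} be the Markov path-space measure on Ω_{x₀} = {(x₁,x₂,…) : r(x₁) = x₀, r(x_{n+1}) = x_n} built from D = Δ, determined by ∫ f dP_{x₀} = Σ_{rⁿ(x_n)=x₀} Δ^{(n)}(x_n) f(x₁,…,x_n) for cylinder functions, where Δ^{(n)} = Δ·(Δ∘r)⋯(Δ∘r^{n-1}).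 Then for all bounded measurable functions f on X_∞(r): ∫_{X_∞(r)} f dμ̂ = ∫_X ∫_{Ω_{x₀}} f(x₀, ω) dP_{x₀}(ω) dμ₀(x₀). -/
open MeasureTheory
open scoped ENNReal

/-- The fiber path space `Ω_{x₀}`: infinite backward orbits starting at `x₀`. -/
def Omega {X : Type} (r : X → X) (x₀ : X) : Set (ℕ → X) :=
  {ω | r (ω 0) = x₀ ∧ ∀ n, r (ω (n + 1)) = ω n}

/-- The identification of a pair `(x₀, ω)`, `ω ∈ Ω_{x₀}`, with the element
`(x₀, x₁, x₂, …)` of `X_∞(r)`. -/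
def glue {X : Type} (r : X → X) (x₀ : X) (ω : Omega r x₀) : Xinf r :=
  ⟨fun n => Nat.rec x₀ (fun k _ => (ω : ℕ → X) k) n, by
    intro n
    cases n with
    | zero => exact ω.2.1
    | succ k => exact ω.2.2 k⟩


/-- The transfer operator built from `Δ`. -/
noncomputable def Ld {X : Type} (r : X → X) (Δ : X → ℝ) (F : X → ℝ) (x : X) : ℝ :=
  ∑' y : r ⁻¹' {x}, Δ y * F y

/-- The `n`-step transfer operator built from `Δ`. -/
noncomputable def Qd {X : Type} (r : X → X) (Δ : X → ℝ) (n : ℕ) (F : X → ℝ) (x : X) : ℝ :=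
  ∑' y : (r^[n]) ⁻¹' {x}, (∏ k ∈ Finset.range n, Δ (r^[k] y)) * F y

lemma fin_iter {X : Type} (r : X → X) (hfin : ∀ x, (r ⁻¹' {x}).Finite) (n : ℕ) :
    ∀ x, ((r^[n]) ⁻¹' {x}).Finite := by
  induction n with
  | zero => intro x; simp
  | succ n ih =>
    intro x
    have : (r^[n+1]) ⁻¹' {x} = (r^[n]) ⁻¹' (r ⁻¹' {x}) := by
      ext y; simp only [Set.mem_preimage, Function.iterate_succ_apply']
    rw [this]
    exact Set.Finite.preimage' (hfin x) (fun b _ => ih b)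

lemma tsum_fin {X : Type} {s : Set X} (hs : s.Finite) (f : X → ℝ) :
    ∑' y : s, f y = ∑ y ∈ hs.toFinset, f y := by
  rw [← Finset.tsum_subtype]
  have : s = (hs.toFinset : Set X) := by simp
  conv_lhs => rw [this]
  rfl

lemma Ld_eq {X : Type} (r : X → X) (hfin : ∀ x, (r ⁻¹' {x}).Finite) (Δ F : X → ℝ) (x : X) :
    Ld r Δ F x = ∑ y ∈ (hfin x).toFinset, Δ y * F y :=
  tsum_fin (hfin x) (fun y => Δ y * F y)

lemma Qd_eq {X : Type} (r : X → X) (hfin : ∀ x, (r ⁻¹' {x}).Finite) (Δ F : X → ℝ) (n : ℕ) (x : X) :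
    Qd r Δ n F x = ∑ y ∈ (fin_iter r hfin n x).toFinset,
      (∏ k ∈ Finset.range n, Δ (r^[k] y)) * F y :=
  tsum_fin (fin_iter r hfin n x) (fun y => (∏ k ∈ Finset.range n, Δ (r^[k] y)) * F y)

lemma Qd_zero {X : Type} (r : X → X) (hfin : ∀ x, (r ⁻¹' {x}).Finite) (Δ F : X → ℝ) :
    Qd r Δ 0 F = F := by
  ext x
  rw [Qd_eq r hfin]
  have : (fin_iter r hfin 0 x).toFinset = {x} := by ext y; simp
  rw [this]; simp

lemma Qd_succ {X : Type} (r : X → X) (hfin : ∀ x, (r ⁻¹' {x}).Finite) (Δ F : X → ℝ) (n : ℕ) :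
    Qd r Δ (n+1) F = Ld r Δ (Qd r Δ n F) := by
  classical
  ext x
  rw [Qd_eq r hfin, Ld_eq r hfin]
  rw [← Finset.sum_fiberwise_of_maps_to (t := (hfin x).toFinset) (g := r^[n])]
  · refine Finset.sum_congr rfl fun z hz => ?_
    rw [Qd_eq r hfin, Finset.mul_sum]
    have hz' : r z = x := by simpa using hz
    refine Finset.sum_congr ?_ ?_
    · ext y
      simp only [Finset.mem_filter, Set.Finite.mem_toFinset, Set.mem_preimage,
        Set.mem_singleton_iff, Function.iterate_succ_apply']
      constructor
      · exact fun h => h.2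
      · rintro rfl; exact ⟨hz', rfl⟩
    · intro y hy
      have hy' : r^[n] y = z := by simpa using hy
      rw [Finset.prod_range_succ, hy']
      ring
  · intro y hy
    simpa only [Set.Finite.mem_toFinset, Set.mem_preimage, Set.mem_singleton_iff,
      Function.iterate_succ_apply'] using hy

lemma Qd_mul {X : Type} (r : X → X) (Δ F g : X → ℝ) (n : ℕ) (x : X) :
    Qd r Δ n (fun y => g (r^[n] y) * F y) x = g x * Qd r Δ n F x := by
  unfold Qd
  rw [← tsum_mul_left]
  refine tsum_congr fun y => ?_
  have : r^[n] y = x := y.2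
  simp only [this]; ring

lemma Ld_bound {X : Type} (r : X → X) (hfin : ∀ x, (r ⁻¹' {x}).Finite) (Δ F : X → ℝ)
    (h0 : ∀ x, 0 ≤ Δ x) (h1 : ∀ x, Ld r Δ (fun _ => 1) x = 1) (C : ℝ) (hF : ∀ x, |F x| ≤ C) (x : X) :
    |Ld r Δ F x| ≤ C := by
  have h := h1 x
  rw [Ld_eq r hfin] at h ⊢
  calc _ ≤ ∑ y ∈ (hfin x).toFinset, |Δ y * F y| := Finset.abs_sum_le_sum_abs _ _
    _ ≤ ∑ y ∈ (hfin x).toFinset, (Δ y * 1) * C := by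
      refine Finset.sum_le_sum fun y _ => ?_
      rw [abs_mul, abs_of_nonneg (h0 y), mul_one]
      exact mul_le_mul_of_nonneg_left (hF y) (h0 y)
    _ = C := by rw [← Finset.sum_mul, h, one_mul]

lemma bdd_integrable {X : Type} [MeasurableSpace X] (μ : Measure X) [IsFiniteMeasure μ]
    (f : X → ℝ) (hf : AEStronglyMeasurable f μ) (C : ℝ) (h : ∀ x, |f x| ≤ C) : Integrable f μ :=
  Integrable.of_bound hf C (Filter.Eventually.of_forall h)

lemma Ld_meas {X : Type} [MeasurableSpace X] (r : X → X)
    (hfin : ∀ x, (r ⁻¹' {x}).Finite)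
    (V : X → ℝ)
    (hV : Measurable V)
    (hVpos : ∀ x, 0 ≤ V x)
    (hVbdd : ∃ C, ∀ x, V x ≤ C)
    (μ₀ : Measure X) [IsFiniteMeasure μ₀]
    (Δ : X → ℝ)
    (h1 : ∀ x, Ld r Δ (fun _ => 1) x = 1)
    (hΔrep : ∀ f : X → ℝ, BddMeasurable f →
      ∫ x, V x * f x ∂μ₀ = ∫ x, Ld r Δ f x ∂μ₀)
    (f : X → ℝ) (hf : BddMeasurable f) : AEStronglyMeasurable (Ld r Δ f) μ₀ := by
  by_cases hμ : μ₀ = 0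
  · subst hμ; exact aestronglyMeasurable_zero_measure _
  by_cases hI : ∫ x, Ld r Δ f x ∂μ₀ = 0
  swap
  · by_contra hn
    exact hI (integral_undef fun h => hn h.1)
  obtain ⟨hfm, C, hC⟩ := hf
  obtain ⟨K, hK⟩ := hVbdd
  have hVa : ∀ x, |V x| ≤ K := fun x => by rw [abs_of_nonneg (hVpos x)]; exact hK x
  have hVi : Integrable V μ₀ := bdd_integrable μ₀ V hV.aestronglyMeasurable K hVa
  have hVf : Integrable (fun x => V x * f x) μ₀ := by
    refine bdd_integrable μ₀ _ (hV.mul hfm).aestronglyMeasurable (K * C) fun x => ?_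
    rw [abs_mul]
    exact mul_le_mul (hVa x) (hC x) (abs_nonneg _) ((abs_nonneg _).trans (hVa x))
  have hb1 : BddMeasurable (fun _ : X => (1:ℝ)) := ⟨measurable_const, 1, by simp⟩
  have hbf1 : BddMeasurable (fun x : X => f x + 1) :=
    ⟨hfm.add_const 1, C + 1, fun x => (abs_add_le _ _).trans (by simpa using hC x)⟩
  have e1 := hΔrep _ hb1
  have e2 := hΔrep _ ⟨hfm, C, hC⟩
  have e3 := hΔrep _ hbf1
  have hL : ∀ x, Ld r Δ (fun x => f x + 1) x = Ld r Δ f x + 1 := by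
    intro x
    have h := h1 x
    rw [Ld_eq r hfin] at h
    rw [Ld_eq r hfin, Ld_eq r hfin]
    simp only [mul_add]
    rw [Finset.sum_add_distrib, h]
  simp only [h1, mul_one, integral_const, smul_eq_mul] at e1
  simp only [mul_add, mul_one, hL] at e3
  rw [integral_add hVf hVi, e2, hI, e1, zero_add] at e3
  have hpos : μ₀.real Set.univ ≠ 0 := by
    simpa [Measure.real, ENNReal.toReal_eq_zero_iff] using hμ
  have hint : Integrable (fun x => Ld r Δ f x + 1) μ₀ := by
    by_contra hn
    exact hpos (e3.trans (integral_undef hn))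
  have := hint.1.add_const (-1)
  simpa using this

lemma Ld_ae {X : Type} [MeasurableSpace X] (r : X → X)
    (hfin : ∀ x, (r ⁻¹' {x}).Finite)
    (V : X → ℝ)
    (hV : Measurable V)
    (hVpos : ∀ x, 0 ≤ V x)
    (hVbdd : ∃ C, ∀ x, V x ≤ C)
    (μ₀ : Measure X) [IsFiniteMeasure μ₀]
    (Δ : X → ℝ)
    (h0 : ∀ x, 0 ≤ Δ x)
    (h1 : ∀ x, Ld r Δ (fun _ => 1) x = 1)
    (hΔrep : ∀ f : X → ℝ, BddMeasurable f →
      ∫ x, V x * f x ∂μ₀ = ∫ x, Ld r Δ f x ∂μ₀)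
    (f g : X → ℝ) (hfg : f =ᵐ[μ₀] g) : Ld r Δ f =ᵐ[μ₀] Ld r Δ g := by
  obtain ⟨N, hN, hNm, hN0⟩ := exists_measurable_superset_of_null (ae_iff.1 hfg)
  set i : X → ℝ := N.indicator (fun _ => 1) with hi
  have hi0 : ∀ x, 0 ≤ i x := fun x => Set.indicator_nonneg (fun _ _ => zero_le_one) x
  have hi1 : ∀ x, |i x| ≤ 1 := fun x => by
    rw [abs_of_nonneg (hi0 x)]
    exact Set.indicator_le_self' (fun _ _ => zero_le_one) x
  have hib : BddMeasurable i := ⟨measurable_const.indicator hNm, 1, hi1⟩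
  have hm := Ld_meas r hfin V hV hVpos hVbdd μ₀ Δ h1 hΔrep i hib
  have hint := bdd_integrable μ₀ _ hm 1 (Ld_bound r hfin Δ i h0 h1 1 hi1)
  have hpos : 0 ≤ Ld r Δ i := fun x => by
    rw [Ld_eq r hfin]
    exact Finset.sum_nonneg fun y _ => mul_nonneg (h0 y) (hi0 y)
  have hz : ∫ x, Ld r Δ i x ∂μ₀ = 0 := by
    rw [← hΔrep i hib]
    apply integral_eq_zero_of_ae
    have : ∀ᵐ x ∂μ₀, x ∉ N := measure_eq_zero_iff_ae_notMem.1 hN0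
    filter_upwards [this] with x hx
    simp [hi, hx]
  have := (integral_eq_zero_iff_of_nonneg hpos hint).1 hz
  filter_upwards [this] with x hx
  rw [Pi.zero_apply, Ld_eq r hfin,
    Finset.sum_eq_zero_iff_of_nonneg (fun y _ => mul_nonneg (h0 y) (hi0 y))] at hx
  rw [Ld_eq r hfin, Ld_eq r hfin]
  refine Finset.sum_congr rfl fun y hy => ?_
  by_cases hyN : y ∈ N
  · have := hx y hy
    simp [hi, hyN] at this
    simp [this]
  · have : f y = g y := by
      by_contra hne
      exact hyN (hN hne)
    rw [this]

lemma Ld_ext {X : Type} [MeasurableSpace X] (r : X → X)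
    (hfin : ∀ x, (r ⁻¹' {x}).Finite)
    (V : X → ℝ)
    (hV : Measurable V)
    (hVpos : ∀ x, 0 ≤ V x)
    (hVbdd : ∃ C, ∀ x, V x ≤ C)
    (μ₀ : Measure X) [IsFiniteMeasure μ₀]
    (Δ : X → ℝ)
    (h0 : ∀ x, 0 ≤ Δ x)
    (h1 : ∀ x, Ld r Δ (fun _ => 1) x = 1)
    (hΔrep : ∀ f : X → ℝ, BddMeasurable f →
      ∫ x, V x * f x ∂μ₀ = ∫ x, Ld r Δ f x ∂μ₀)
    (f : X → ℝ) (hf : AEStronglyMeasurable f μ₀) (C : ℝ) (hC : ∀ x, |f x| ≤ C) :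
    AEStronglyMeasurable (Ld r Δ f) μ₀ ∧ ∫ x, V x * f x ∂μ₀ = ∫ x, Ld r Δ f x ∂μ₀ := by
  by_cases hX : Nonempty X
  swap
  · have := not_nonempty_iff.1 hX
    have h : μ₀ = 0 := Measure.eq_zero_of_isEmpty μ₀
    subst h
    simp
  have hC0 : 0 ≤ C := (abs_nonneg _).trans (hC hX.some)
  obtain ⟨g, hg, hfg⟩ := hf
  set g' : X → ℝ := fun x => max (-C) (min C (g x)) with hg'
  have hg'b : BddMeasurable g' :=
    ⟨measurable_const.max (measurable_const.min hg.measurable), C, fun x => by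
      rw [abs_le]
      exact ⟨le_max_left _ _, max_le (by linarith) (min_le_left _ _)⟩⟩
  have hfg' : f =ᵐ[μ₀] g' := by
    filter_upwards [hfg] with x hx
    have := abs_le.1 (hC x)
    simp only [hg', ← hx]
    rw [min_eq_right this.2, max_eq_right this.1]
  have hL := Ld_ae r hfin V hV hVpos hVbdd μ₀ Δ h0 h1 hΔrep f g' hfg'
  refine ⟨(Ld_meas r hfin V hV hVpos hVbdd μ₀ Δ h1 hΔrep g' hg'b).congr hL.symm, ?_⟩
  rw [integral_congr_ae hL, ← hΔrep g' hg'b]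
  apply integral_congr_ae
  filter_upwards [hfg'] with x hx
  rw [hx]

lemma Qd_bound {X : Type} (r : X → X)
    (hfin : ∀ x, (r ⁻¹' {x}).Finite)
    (Δ : X → ℝ)
    (h0 : ∀ x, 0 ≤ Δ x)
    (h1 : ∀ x, Ld r Δ (fun _ => 1) x = 1)
    (F : X → ℝ) (C : ℝ) (hC : ∀ x, |F x| ≤ C) (n : ℕ) : ∀ x, |Qd r Δ n F x| ≤ C := by
  induction n with
  | zero => rw [Qd_zero r hfin]; exact hC
  | succ n ih => rw [Qd_succ r hfin]; exact Ld_bound r hfin Δ _ h0 h1 C ih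

lemma Qd_meas {X : Type} [MeasurableSpace X] (r : X → X)
    (hfin : ∀ x, (r ⁻¹' {x}).Finite)
    (V : X → ℝ)
    (hV : Measurable V)
    (hVpos : ∀ x, 0 ≤ V x)
    (hVbdd : ∃ C, ∀ x, V x ≤ C)
    (μ₀ : Measure X) [IsFiniteMeasure μ₀]
    (Δ : X → ℝ)
    (h0 : ∀ x, 0 ≤ Δ x)
    (h1 : ∀ x, Ld r Δ (fun _ => 1) x = 1)
    (hΔrep : ∀ f : X → ℝ, BddMeasurable f →
      ∫ x, V x * f x ∂μ₀ = ∫ x, Ld r Δ f x ∂μ₀)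
    (F : X → ℝ) (hF : Measurable F) (C : ℝ) (hC : ∀ x, |F x| ≤ C) (n : ℕ) :
    AEStronglyMeasurable (Qd r Δ n F) μ₀ := by
  induction n with
  | zero => rw [Qd_zero r hfin]; exact hF.aestronglyMeasurable
  | succ n ih =>
    rw [Qd_succ r hfin]
    exact (Ld_ext r hfin V hV hVpos hVbdd μ₀ Δ h0 h1 hΔrep _ ih C
      (Qd_bound r hfin Δ h0 h1 F C hC n)).1

lemma theta_meas {X : Type} [MeasurableSpace X] (r : X → X)
    (n : ℕ) : Measurable (theta r n) :=
  (measurable_pi_apply n).comp measurable_subtype_coe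

lemma rhatInv_meas {X : Type} [MeasurableSpace X] (r : X → X)
    : Measurable (rhatInv r) :=
  Measurable.subtype_mk (measurable_pi_lambda (fun (xh : Xinf r) n => (xh : ℕ → X) (n + 1)) fun n =>
    (measurable_pi_apply (n+1)).comp measurable_subtype_coe)

lemma theta_iter {X : Type} (r : X → X)
    (n m : ℕ) (xh : Xinf r) : r^[n] (theta r (m + n) xh) = theta r m xh := by
  induction n with
  | zero => rfl
  | succ n ih =>
    rw [Function.iterate_succ_apply, ← ih]
    congr 1
    exact xh.2 (m + n)

lemma hat_theta {X : Type} [MeasurableSpace X] (r : X → X)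
    (hfin : ∀ x, (r ⁻¹' {x}).Finite)
    (V : X → ℝ)
    (hV : Measurable V)
    (hVpos : ∀ x, 0 ≤ V x)
    (hVbdd : ∃ C, ∀ x, V x ≤ C)
    (μ₀ : Measure X) [IsFiniteMeasure μ₀]
    (Δ : X → ℝ)
    (h0 : ∀ x, 0 ≤ Δ x)
    (h1 : ∀ x, Ld r Δ (fun _ => 1) x = 1)
    (hΔrep : ∀ f : X → ℝ, BddMeasurable f →
      ∫ x, V x * f x ∂μ₀ = ∫ x, Ld r Δ f x ∂μ₀)
    (hr : Measurable r) (μhat : Measure (Xinf r))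
    (hqi : μhat.map (rhatInv r) =
      μhat.withDensity fun xh => ENNReal.ofReal (V (theta r 0 xh)))
    (hθ0 : μhat.map (theta r 0) = μ₀) (n : ℕ) :
    ∀ (F : X → ℝ), Measurable F → (∃ C, ∀ x, |F x| ≤ C) →
      ∫ xh, F (theta r n xh) ∂μhat = ∫ x, Qd r Δ n F x ∂μ₀ := by
  induction n with
  | zero =>
    intro F hF _
    rw [Qd_zero r hfin, ← hθ0,
      integral_map (theta_meas r 0).aemeasurable hF.aestronglyMeasurable]
  | succ n ih =>
    rintro F hF ⟨C, hC⟩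
    obtain ⟨K, hK⟩ := hVbdd
    have hVa : ∀ x, |V x| ≤ K := fun x => by rw [abs_of_nonneg (hVpos x)]; exact hK x
    have e1 : ∫ xh, F (theta r (n+1) xh) ∂μhat = ∫ xh, F (theta r n xh) ∂(μhat.map (rhatInv r)) := by
      rw [integral_map (f := fun xh => F (theta r n xh)) (rhatInv_meas r).aemeasurable
        (hF.comp (theta_meas r n)).aestronglyMeasurable]
      rfl
    rw [e1, hqi, integral_withDensity_eq_integral_toReal_smul
      (f := fun xh => ENNReal.ofReal (V (theta r 0 xh))) (hV.comp (theta_meas r 0)).ennreal_ofReal (by simp)]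
    have e2 : ∀ xh : Xinf r, (ENNReal.ofReal (V (theta r 0 xh))).toReal • F (theta r n xh)
        = (fun y => V (r^[n] y) * F y) (theta r n xh) := by
      intro xh
      have := theta_iter r n 0 xh
      rw [zero_add] at this
      simp only [this, smul_eq_mul, ENNReal.toReal_ofReal (hVpos _)]
    simp only [e2]
    rw [ih (fun y => V (r^[n] y) * F y) ((hV.comp (hr.iterate n)).mul hF) ⟨K * C, fun x => by
      rw [abs_mul]
      exact mul_le_mul (hVa _) (hC x) (abs_nonneg _) ((abs_nonneg _).trans (hVa x))⟩]
    simp only [Qd_mul]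
    rw [Qd_succ r hfin]
    exact (Ld_ext r hfin V hV hVpos ⟨K, hK⟩ μ₀ Δ h0 h1 hΔrep _
      (Qd_meas r hfin V hV hVpos ⟨K, hK⟩ μ₀ Δ h0 h1 hΔrep F hF C hC n) C
      (Qd_bound r hfin Δ h0 h1 F C hC n)).2

lemma glue_meas {X : Type} [MeasurableSpace X] (r : X → X)
    (x : X) : Measurable (glue r x) := by
  refine (measurable_pi_lambda _ fun n => ?_).subtype_mk
  cases n with
  | zero => exact measurable_const
  | succ k => exact (measurable_pi_apply k).comp measurable_subtype_coe

/-- The generating pi-system of cylinder sets. -/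
def cyl {X : Type} [MeasurableSpace X] (r : X → X)
    : Set (Set (Xinf r)) := {S | ∃ (n : ℕ) (A : Set X), MeasurableSet A ∧ S = theta r n ⁻¹' A}

lemma cyl_pi {X : Type} [MeasurableSpace X] (r : X → X)
    (hr : Measurable r) : IsPiSystem (cyl r) := by
  have key : ∀ (m k : ℕ) (A B : Set X), MeasurableSet A → MeasurableSet B →
      theta r m ⁻¹' A ∩ theta r (m+k) ⁻¹' B ∈ cyl r := by
    intro m k A B hA hB
    refine ⟨m + k, (r^[k]) ⁻¹' A ∩ B, ((hr.iterate k) hA).inter hB, ?_⟩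
    ext xh
    simp [theta_iter]
  rintro _ ⟨m, A, hA, rfl⟩ _ ⟨n, B, hB, rfl⟩ _
  rcases le_total m n with h | h
  · obtain ⟨k, rfl⟩ := Nat.exists_eq_add_of_le h
    exact key m k A B hA hB
  · obtain ⟨k, rfl⟩ := Nat.exists_eq_add_of_le h
    rw [Set.inter_comm]
    exact key n k B A hB hA

lemma cyl_gen {X : Type} [MeasurableSpace X] (r : X → X)
    : (inferInstance : MeasurableSpace (Xinf r)) = MeasurableSpace.generateFrom (cyl r) := by
  apply le_antisymm
  · have : Measurable[MeasurableSpace.generateFrom (cyl r)] (fun x : Xinf r => (x : ℕ → X)) := by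
      refine @measurable_pi_lambda _ _ _ (MeasurableSpace.generateFrom (cyl r)) _ _ fun n => ?_
      intro A hA
      exact MeasurableSpace.measurableSet_generateFrom ⟨n, A, hA, rfl⟩
    exact this.comap_le
  · refine MeasurableSpace.generateFrom_le ?_
    rintro _ ⟨n, A, hA, rfl⟩
    exact theta_meas r n hA

/-- Theorem 5.23: the `V`-quasi-invariant measure `μ̂` on `X_∞(r)` disintegrates over the
Markov path-space measures `P_{x₀}` built from the modular function `Δ`:
`∫ f dμ̂ = ∫_X ∫_{Ω_{x₀}} f(x₀, ω) dP_{x₀}(ω) dμ₀(x₀)` for all bounded measurable `f`. -/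
theorem disintegration_over_markov_process
    (X : Type) [MeasurableSpace X] (r : X → X) (hr : Measurable r)
    (hsur : Function.Surjective r) (hfin : ∀ x, (r ⁻¹' {x}).Finite)
    (V : X → ℝ) (hV : Measurable V) (hVpos : ∀ x, 0 ≤ V x) (hVbdd : ∃ C, ∀ x, V x ≤ C)
    (μ₀ : Measure X) [IsFiniteMeasure μ₀]
    (hfix : ∀ f : X → ℝ, BddMeasurable f → ∫ x, V x * f (r x) ∂μ₀ = ∫ x, f x ∂μ₀)
    (Δ : X → ℝ) (hΔmeas : Measurable Δ) (hΔ01 : ∀ x, 0 ≤ Δ x ∧ Δ x ≤ 1)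
    (hΔsum : ∀ᵐ x ∂μ₀, (∑' y : r ⁻¹' {x}, Δ y) = 1)
    (hΔrep : ∀ f : X → ℝ, BddMeasurable f →
      ∫ x, V x * f x ∂μ₀ = ∫ x, ∑' y : r ⁻¹' {x}, Δ y * f y ∂μ₀)
    (μhat : Measure (Xinf r))
    (hqi : μhat.map (rhatInv r) =
      μhat.withDensity fun xh => ENNReal.ofReal (V (theta r 0 xh)))
    (hθ0 : μhat.map (theta r 0) = μ₀)
    (P : (x₀ : X) → Measure (Omega r x₀))
    (hP : ∀ (x₀ : X), IsProbabilityMeasure (P x₀) ∧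
      ∀ (n : ℕ) (F : X → ℝ), Measurable F → (∃ C, ∀ x, |F x| ≤ C) →
        ∫ ω, F ((ω : ℕ → X) n) ∂(P x₀) =
          ∑' y : (r^[n + 1]) ⁻¹' {x₀},
            (∏ k ∈ Finset.range (n + 1), Δ (r^[k] y)) * F y) :
    ∀ f : Xinf r → ℝ, Measurable f → (∃ C, ∀ xh, |f xh| ≤ C) →
      ∫ xh, f xh ∂μhat = ∫ x₀, (∫ ω, f (glue r x₀ ω) ∂(P x₀)) ∂μ₀ := by
  have hPp : ∀ x, IsProbabilityMeasure (P x) := fun x => (hP x).1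
  have h0 : ∀ x, 0 ≤ Δ x := fun x => (hΔ01 x).1
  have hPQ : ∀ (x₀ : X) (n : ℕ) (F : X → ℝ), Measurable F → (∃ C, ∀ x, |F x| ≤ C) →
      ∫ ω, F ((ω : ℕ → X) n) ∂(P x₀) = Qd r Δ (n+1) F x₀ := fun x₀ => (hP x₀).2
  have h1 : ∀ x, Ld r Δ (fun _ => 1) x = 1 := by
    intro x
    have := hPQ x 0 (fun _ => 1) measurable_const ⟨1, by simp⟩
    rw [Qd_succ r hfin, Qd_zero r hfin] at this
    rw [← this]; simp
  have hrep : ∀ f : X → ℝ, BddMeasurable f →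
      ∫ x, V x * f x ∂μ₀ = ∫ x, Ld r Δ f x ∂μ₀ := hΔrep
  have hhat : IsFiniteMeasure μhat := by
    constructor
    have : μhat.map (theta r 0) Set.univ = μhat Set.univ := by
      rw [Measure.map_apply (theta_meas r 0) MeasurableSet.univ, Set.preimage_univ]
    rw [← this, hθ0]
    exact measure_lt_top _ _
  -- cylinder sets
  have hset : ∀ S : Set (Xinf r), MeasurableSet S →
      AEMeasurable (fun x => P x (glue r x ⁻¹' S)) μ₀ ∧
      ∫⁻ x, P x (glue r x ⁻¹' S) ∂μ₀ = μhat S := by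
    have huniv : ∫⁻ _x, (1:ℝ≥0∞) ∂μ₀ = μhat Set.univ := by
      rw [lintegral_one, ← hθ0, Measure.map_apply (theta_meas r 0) MeasurableSet.univ,
        Set.preimage_univ]
    intro S hS
    induction S, hS using MeasurableSpace.induction_on_inter (cyl_gen r) (cyl_pi r hr) with
    | empty => simp
    | basic t ht =>
      obtain ⟨n, A, hA, rfl⟩ := ht
      set F : X → ℝ := A.indicator (fun _ => 1) with hFd
      have hF : Measurable F := measurable_const.indicator hA
      have hF0 : ∀ x, 0 ≤ F x := fun x => Set.indicator_nonneg (fun _ _ => zero_le_one) x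
      have hF1 : ∀ x, |F x| ≤ 1 := fun x => by
        rw [abs_of_nonneg (hF0 x)]
        exact Set.indicator_le_self' (fun _ _ => zero_le_one) x
      have hm := Qd_meas r hfin V hV hVpos hVbdd μ₀ Δ h0 h1 hrep F hF 1 hF1 n
      have hx : ∀ x, P x (glue r x ⁻¹' (theta r n ⁻¹' A)) = ENNReal.ofReal (Qd r Δ n F x) := by
        intro x
        cases n with
        | zero =>
          rw [Qd_zero r hfin]
          by_cases hxA : x ∈ A
          · have : glue r x ⁻¹' (theta r 0 ⁻¹' A) = Set.univ := by
              ext ω; simp [glue, theta, hxA]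
            rw [this]; simp [hFd, hxA]
          · have : glue r x ⁻¹' (theta r 0 ⁻¹' A) = ∅ := by
              ext ω; simp [glue, theta, hxA]
            rw [this]; simp [hFd, hxA]
        | succ k =>
          rw [← hPQ x k F hF ⟨1, hF1⟩]
          have hB : MeasurableSet (glue r x ⁻¹' (theta r (k+1) ⁻¹' A)) :=
            glue_meas r x (theta_meas r (k+1) hA)
          have : (fun ω : Omega r x => F ((ω : ℕ → X) k)) =
              (glue r x ⁻¹' (theta r (k+1) ⁻¹' A)).indicator (fun _ => 1) := by
            ext ω
            simp only [hFd, Set.indicator]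
            rfl
          rw [this, integral_indicator_const _ hB]
          simp
      have hQ0 : ∀ x, 0 ≤ Qd r Δ n F x := fun x => by
        rw [Qd_eq r hfin]
        exact Finset.sum_nonneg fun y _ =>
          mul_nonneg (Finset.prod_nonneg fun k _ => h0 _) (hF0 y)
      simp only [hx]
      refine ⟨hm.aemeasurable.ennreal_ofReal, ?_⟩
      have hQi := bdd_integrable μ₀ _ hm 1 (Qd_bound r hfin Δ h0 h1 F 1 hF1 n)
      rw [← ofReal_integral_eq_lintegral_ofReal hQi (Filter.Eventually.of_forall hQ0),
        ← hat_theta r hfin V hV hVpos hVbdd μ₀ Δ h0 h1 hrep hr μhat hqi hθ0 n F hF ⟨1, hF1⟩]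
      have : (fun xh : Xinf r => F (theta r n xh)) =
          (theta r n ⁻¹' A).indicator (fun _ => 1) := by
        ext ω
        simp only [hFd, Set.indicator]
        rfl
      rw [this, integral_indicator_const _ (theta_meas r n hA)]
      simp
    | compl t htm ih =>
      have hc : ∀ x, P x (glue r x ⁻¹' tᶜ) = 1 - P x (glue r x ⁻¹' t) := fun x => by
        rw [Set.preimage_compl, prob_compl_eq_one_sub (glue_meas r x htm)]
      simp only [hc]
      refine ⟨aemeasurable_const.sub ih.1, ?_⟩
      rw [lintegral_sub' ih.1 (by rw [ih.2]; exact measure_ne_top _ _)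
        (Filter.Eventually.of_forall fun x => prob_le_one), ih.2, huniv,
        measure_compl htm (measure_ne_top _ _)]
    | iUnion f hd hfm ih =>
      have hc : ∀ x, P x (glue r x ⁻¹' (⋃ i, f i)) = ∑' i, P x (glue r x ⁻¹' (f i)) := fun x => by
        rw [Set.preimage_iUnion, measure_iUnion (fun i j hij => (hd hij).preimage _)
          (fun i => glue_meas r x (hfm i))]
      simp only [hc]
      refine ⟨AEMeasurable.tsum fun i => (ih i).1, ?_⟩
      rw [lintegral_tsum (fun i => (ih i).1), measure_iUnion hd hfm]
      exact tsum_congr fun i => (ih i).2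
  -- nonnegative functions
  have hfun : ∀ f : Xinf r → ℝ≥0∞, Measurable f →
      AEMeasurable (fun x => ∫⁻ ω, f (glue r x ω) ∂(P x)) μ₀ ∧
      ∫⁻ x, ∫⁻ ω, f (glue r x ω) ∂(P x) ∂μ₀ = ∫⁻ xh, f xh ∂μhat := by
    intro f hf
    refine Measurable.ennreal_induction (motive := fun f : Xinf r → ℝ≥0∞ =>
      AEMeasurable (fun x => ∫⁻ ω, f (glue r x ω) ∂(P x)) μ₀ ∧
      ∫⁻ x, ∫⁻ ω, f (glue r x ω) ∂(P x) ∂μ₀ = ∫⁻ xh, f xh ∂μhat) ?_ ?_ ?_ hf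
    · intro c S hS
      have hx : ∀ x, ∫⁻ ω, S.indicator (fun _ => c) (glue r x ω) ∂(P x)
          = c * P x (glue r x ⁻¹' S) := fun x => by
        rw [← lintegral_indicator_const (glue_meas r x hS)]
        rfl
      simp only [hx]
      refine ⟨(hset S hS).1.const_mul c, ?_⟩
      rw [lintegral_const_mul'' c (hset S hS).1, (hset S hS).2, lintegral_indicator_const hS]
    · intro f g _ hf hg ihf ihg
      have hx : ∀ x, ∫⁻ ω, (f + g) (glue r x ω) ∂(P x)
          = ∫⁻ ω, f (glue r x ω) ∂(P x) + ∫⁻ ω, g (glue r x ω) ∂(P x) := fun x => by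
        exact lintegral_add_left (hf.comp (glue_meas r x)) (fun ω => g (glue r x ω))
      simp only [hx]
      refine ⟨ihf.1.add ihg.1, ?_⟩
      rw [lintegral_add_left' ihf.1, ihf.2, ihg.2, ← lintegral_add_left hf]
      rfl
    · intro f hf hmono ih
      have hx : ∀ x, ∫⁻ ω, ⨆ n, f n (glue r x ω) ∂(P x)
          = ⨆ n, ∫⁻ ω, f n (glue r x ω) ∂(P x) := fun x =>
        lintegral_iSup (fun n => (hf n).comp (glue_meas r x)) (fun i j hij ω => hmono hij _)
      simp only [hx]
      refine ⟨AEMeasurable.iSup fun n => (ih n).1, ?_⟩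
      rw [lintegral_iSup' (fun n => (ih n).1) (Filter.Eventually.of_forall fun x i j hij =>
        lintegral_mono fun ω => hmono hij _), lintegral_iSup hf hmono]
      exact iSup_congr fun n => (ih n).2
  rintro f hf ⟨C, hC⟩
  have hg := hfun (fun xh => ENNReal.ofReal (f xh + C)) (hf.add_const C).ennreal_ofReal
  have hpos : ∀ xh, 0 ≤ f xh + C := fun xh => by linarith [(abs_le.1 (hC xh)).1]
  have hfi : Integrable f μhat := Integrable.of_bound hf.aestronglyMeasurable C
    (Filter.Eventually.of_forall hC)
  have hfx : ∀ x, Integrable (fun ω => f (glue r x ω)) (P x) := fun x =>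
    Integrable.of_bound (hf.comp (glue_meas r x)).aestronglyMeasurable C
      (Filter.Eventually.of_forall fun ω => hC _)
  have hin : ∀ x, ∫ ω, f (glue r x ω) ∂(P x) =
      (∫⁻ ω, ENNReal.ofReal (f (glue r x ω) + C) ∂(P x)).toReal - C := fun x => by
    rw [← integral_eq_lintegral_of_nonneg_ae (Filter.Eventually.of_forall fun ω => hpos _)
      ((hfx x).add (integrable_const C)).1, integral_add (hfx x) (integrable_const C)]
    simp
  have hout : ∫ xh, f xh ∂μhat + ∫ xh, C ∂μhat =
      (∫⁻ xh, ENNReal.ofReal (f xh + C) ∂μhat).toReal := by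
    rw [← integral_eq_lintegral_of_nonneg_ae (Filter.Eventually.of_forall fun ω => hpos _)
      (hfi.add (integrable_const C)).1, integral_add hfi (integrable_const C)]
  have hlt : ∀ x, ∫⁻ ω, ENNReal.ofReal (f (glue r x ω) + C) ∂(P x) < ⊤ := fun x =>
    ((hfx x).add (integrable_const C)).lintegral_lt_top
  have hne : ∫⁻ x, ∫⁻ ω, ENNReal.ofReal (f (glue r x ω) + C) ∂(P x) ∂μ₀ ≠ ⊤ := by
    rw [hg.2]
    exact (hfi.add (integrable_const C)).lintegral_lt_top.ne
  simp only [hin]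
  rw [integral_sub (integrable_toReal_of_lintegral_ne_top hg.1 hne) (integrable_const C),
    integral_toReal hg.1 (Filter.Eventually.of_forall hlt), hg.2, ← hout]
  have : μhat.real Set.univ = μ₀.real Set.univ := by
    rw [← hθ0, Measure.real, Measure.real, Measure.map_apply (theta_meas r 0) MeasurableSet.univ,
        Set.preimage_univ]
  simp [this]
end
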